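/- arXiv:2208.09025 — 3 statements merged into one kernel-verified Lean document; each statement's English description precedes it below -/
import Mathlib

section
/- Let π be a juggling function of period n and let C be a π-frieze over a field 𝕜. Then the entries of C are n-periodic: C_{a,b} = C_{a+n,b+n} for all a, b ∈ ℤ. -/
open Finset

variable {K : Type*} [Field K]

/-- A juggling function of period `n`: a bijection `π : ℤ → ℤ` with
`i ≤ π i ≤ i + n` and `π (i + n) = π i + n` for all `i`. -/
structure IsJuggling (n : ℕ) (π : ℤ ≃ ℤ) : Prop where
  npos : 0 < n
  le_self : ∀ i : ℤ, i ≤ π i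
  le_add : ∀ i : ℤ, π i ≤ i + n
  periodic : ∀ i : ℤ, π (i + n) = π i + n

/-- The juggling function `π` of period `n` has `h` balls. -/
def HasBalls (n : ℕ) (π : ℤ ≃ ℤ) (h : ℕ) : Prop :=
  ∑ i ∈ Finset.Icc (1 : ℤ) (n : ℤ), (π i - i) = (h : ℤ) * n

/-- The dual juggling function `π†`, `a ↦ π⁻¹ a + n`. -/
def dualJug (n : ℕ) (π : ℤ ≃ ℤ) : ℤ ≃ ℤ :=
  π.symm.trans (Equiv.addRight (n : ℤ))

/-- A `π`-prefrieze: `C a b = 1` if `a = b`; `C a b = (-1)^|S_π(b,a)|` if `a = π b`;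
and `C a b = 0` whenever `a ∉ [b, π b]` or `b ∉ [π⁻¹ a, a]`. -/
def IsPrefrieze (π : ℤ ≃ ℤ) (C : ℤ → ℤ → K) : Prop :=
  ∀ a b : ℤ,
    (a = b → C a b = 1) ∧
    (a = π b → C a b = (-1 : K) ^ Set.ncard {i : ℤ | b < i ∧ π i < a}) ∧
    (¬(b ≤ a ∧ a ≤ π b) ∨ ¬(π.symm a ≤ b ∧ b ≤ a) → C a b = 0)

/-- The determinant of the square submatrix of the `ℤ×ℤ` matrix `C` with rows indexed
by `I` and columns by `J`, each taken in increasing order (junk value `0` if the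
cardinalities differ). -/
noncomputable def minor (C : ℤ → ℤ → K) (I J : Finset ℤ) : K :=
  if h : J.card = I.card then
    Matrix.det (Matrix.of fun i j : Fin I.card =>
      C (I.orderEmbOfFin rfl i) (J.orderEmbOfFin h j))
  else 0

/-- A `π`-frieze: a `π`-prefrieze satisfying the frieze and tameness conditions. -/
def IsFrieze (n : ℕ) (π : ℤ ≃ ℤ) (C : ℤ → ℤ → K) : Prop :=
  IsPrefrieze π C ∧
  -- the frieze condition
  (∀ a b : ℤ, dualJug n π a ≤ b → b < a + n → a + n ≤ π b →
    minor C
      (Finset.Icc a b \ (Finset.Icc a b).filter (fun i => dualJug n π i ≤ b))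
      (Finset.Icc a b \
        ((Finset.Icc a b).filter (fun i => dualJug n π i ≤ b)).image (dualJug n π)) = 1) ∧
  -- the tameness condition
  (∀ a b : ℤ, (dualJug n π a < b ∧ b < a + n) ∨ (b < a + n ∧ a + n < π b) →
    minor C
      (Finset.Ioc a b \ (Finset.Ioo a b).filter (fun i => dualJug n π i < b))
      (Finset.Ico a b \
        ((Finset.Ioo a b).filter (fun i => dualJug n π i < b)).image (dualJug n π)) = 0)

theorem minor_eq_of {m : ℕ} (C : ℤ → ℤ → K) (I J : Finset ℤ) (f g : Fin m → ℤ)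
    (hf : StrictMono f) (hg : StrictMono g) (hI : Finset.univ.image f = I)
    (hJ : Finset.univ.image g = J) :
    minor C I J = Matrix.det (Matrix.of fun i j => C (f i) (g j)) := by
  have cI : I.card = m := by
    rw [← hI, Finset.card_image_of_injective _ hf.injective]; simp
  have cJ : J.card = m := by
    rw [← hJ, Finset.card_image_of_injective _ hg.injective]; simp
  subst cI
  have e1 : f = I.orderEmbOfFin rfl :=
    Finset.orderEmbOfFin_unique rfl (fun x => by rw [← hI]; simp) hf
  have e2 : g = J.orderEmbOfFin cJ :=
    Finset.orderEmbOfFin_unique cJ (fun x => by rw [← hJ]; simp) hg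
  unfold minor
  rw [dif_pos cJ, e1, e2]

theorem minor_data (C : ℤ → ℤ → K) (I J : Finset ℤ) (h : minor C I J ≠ 0) :
    ∃ (m : ℕ) (f g : Fin m → ℤ), StrictMono f ∧ StrictMono g ∧ Finset.univ.image f = I ∧
      Finset.univ.image g = J ∧ m = J.card ∧
      minor C I J = Matrix.det (Matrix.of fun i j => C (f i) (g j)) := by
  have hc : J.card = I.card := by
    by_contra hne
    exact h (by unfold minor; rw [dif_neg hne])
  refine ⟨I.card, I.orderEmbOfFin rfl, J.orderEmbOfFin hc, (I.orderEmbOfFin rfl).strictMono,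
    (J.orderEmbOfFin hc).strictMono, by simp, by simp, hc.symm, ?_⟩
  unfold minor
  rw [dif_pos hc]

theorem strictMono_cons' {m : ℕ} (a : ℤ) (f : Fin m → ℤ) (hf : StrictMono f)
    (h : ∀ i, a < f i) : StrictMono (Fin.cons a f : Fin (m+1) → ℤ) := by
  intro i j hij
  induction i using Fin.cases with
  | zero =>
    induction j using Fin.cases with
    | zero => exact absurd hij (lt_irrefl _)
    | succ j => simpa using h j
  | succ i =>
    induction j using Fin.cases with
    | zero => exact absurd hij (by simp)
    | succ j => simpa using hf (by simpa using hij)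

theorem strictMono_snoc' {m : ℕ} (b : ℤ) (f : Fin m → ℤ) (hf : StrictMono f)
    (h : ∀ i, f i < b) : StrictMono (Fin.snoc f b : Fin (m+1) → ℤ) := by
  intro i j hij
  induction i using Fin.lastCases with
  | last => exact absurd hij (not_lt.2 (Fin.le_last j))
  | cast i =>
    induction j using Fin.lastCases with
    | last => simpa using h i
    | cast j => simpa using hf (by simpa using hij)

theorem image_cons' {m : ℕ} (a : ℤ) (f : Fin m → ℤ) :
    Finset.univ.image (Fin.cons a f : Fin (m+1) → ℤ) = insert a (Finset.univ.image f) := by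
  ext x
  simp [Fin.exists_fin_succ, eq_comm]

theorem image_snoc' {m : ℕ} (b : ℤ) (f : Fin m → ℤ) :
    Finset.univ.image (Fin.snoc f b : Fin (m+1) → ℤ) = insert b (Finset.univ.image f) := by
  ext x
  simp [Fin.exists_fin_succ', eq_comm, or_comm]

/-- Cramer's rule. -/
theorem minor_cramer (C : ℤ → ℤ → K) (R Q : Finset ℤ) (a b : ℤ) (hF : minor C R Q = 1)
    (ha : ∀ q ∈ Q, a < q) (hb : ∀ r ∈ R, r < b) (v : ℤ → K) (w : K) (hva : v a = 1)
    (hR : ∀ r ∈ R, ∑ c ∈ insert a Q, C r c * v c = 0)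
    (hw : ∑ c ∈ insert a Q, C b c * v c = w) :
    minor C (insert b R) (insert a Q) = (-1) ^ Q.card * w := by
  obtain ⟨m, f, g, hf, hg, rfl, rfl, hm, he⟩ := minor_data C R Q (by rw [hF]; exact one_ne_zero)
  have hg' := strictMono_cons' a g hg (fun i => ha _ (by simp))
  have hf' := strictMono_snoc' b f hf (fun i => hb _ (by simp))
  rw [minor_eq_of C _ _ _ _ hf' hg' (image_snoc' b f) (image_cons' a g)]
  rw [hF] at he
  set A : Matrix (Fin (m+1)) (Fin (m+1)) K :=
    Matrix.of fun i j => C ((Fin.snoc f b : Fin (m+1) → ℤ) i) ((Fin.cons a g : Fin (m+1) → ℤ) j)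
    with hA
  let u : Fin (m+1) → K := fun j => v ((Fin.cons a g : Fin (m+1) → ℤ) j)
  have hAu : ∀ i, (A.mulVec u) i =
      ∑ c ∈ insert a (Finset.univ.image g), C ((Fin.snoc f b : Fin (m+1) → ℤ) i) c * v c := by
    intro i
    rw [← image_cons', Finset.sum_image (fun x _ y _ h => hg'.injective h)]
    simp [Matrix.mulVec, dotProduct, A, u]
  have hAu' : A.mulVec u = Pi.single (Fin.last m) w := by
    ext i
    rw [hAu]
    induction i using Fin.lastCases with
    | last => simpa using hw
    | cast i =>
      rw [Pi.single_eq_of_ne (Fin.castSucc_lt_last i).ne]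
      simpa using hR (f i) (by simp)
  have h1 : A.adjugate.mulVec (A.mulVec u) = A.det • u := by
    rw [Matrix.mulVec_mulVec, Matrix.adjugate_mul, Matrix.smul_mulVec, Matrix.one_mulVec]
  have h2 := congrFun h1 0
  rw [hAu'] at h2
  simp only [Matrix.mulVec_single, Pi.smul_apply, smul_eq_mul, u, Fin.cons_zero, hva, mul_one,
    Matrix.col_apply, MulOpposite.smul_eq_mul_unop, MulOpposite.unop_op] at h2
  rw [← h2, Matrix.adjugate_fin_succ_eq_det_submatrix, ← hm]
  have h3 : A.submatrix (Fin.last m).succAbove (Fin.succAbove 0) =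
      Matrix.of fun i j => C (f i) (g j) := by
    ext i j
    simp [A]
  rw [h3, ← he]
  simp

theorem minor_first (C : ℤ → ℤ → K) (R Q : Finset ℤ) (a : ℤ) (hF : minor C R Q = 1)
    (ha : ∀ q ∈ Q, a < q) (hb : ∀ r ∈ R, a < r) (h1 : C a a = 1)
    (h0 : ∀ q ∈ Q, C a q = 0) :
    minor C (insert a R) (insert a Q) = 1 := by
  obtain ⟨m, f, g, hf, hg, rfl, rfl, hm, he⟩ := minor_data C R Q (by rw [hF]; exact one_ne_zero)
  have hg' := strictMono_cons' a g hg (fun i => ha _ (by simp))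
  have hf' := strictMono_cons' a f hf (fun i => hb _ (by simp))
  rw [minor_eq_of C _ _ _ _ hf' hg' (image_cons' a f) (image_cons' a g), Matrix.det_succ_row_zero,
    Fin.sum_univ_succ, Finset.sum_eq_zero]
  · rw [hF] at he
    simp only [Matrix.of_apply, Fin.cons_zero, h1, add_zero]
    simp only [Fin.val_zero, pow_zero, one_mul]
    rw [he]
    congr 1
  · intro i _
    simp [h0 (g i) (by simp)]

theorem minor_last (C : ℤ → ℤ → K) (R Q : Finset ℤ) (a : ℤ) (hF : minor C R Q = 1)
    (ha : ∀ q ∈ Q, q < a) (hb : ∀ r ∈ R, r < a) (h1 : C a a = 1)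
    (h0 : ∀ q ∈ R, C q a = 0) :
    minor C (insert a R) (insert a Q) = 1 := by
  obtain ⟨m, f, g, hf, hg, rfl, rfl, hm, he⟩ := minor_data C R Q (by rw [hF]; exact one_ne_zero)
  have hg' := strictMono_snoc' a g hg (fun i => ha _ (by simp))
  have hf' := strictMono_snoc' a f hf (fun i => hb _ (by simp))
  rw [minor_eq_of C _ _ _ _ hf' hg' (image_snoc' a f) (image_snoc' a g),
    Matrix.det_succ_column _ (Fin.last m),
    Fin.sum_univ_castSucc, Finset.sum_eq_zero]
  · rw [hF] at he
    simp only [Matrix.of_apply, Fin.snoc_last, h1, zero_add]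
    rw [Even.neg_one_pow ⟨_, rfl⟩, one_mul, one_mul]
    refine Eq.trans ?_ he.symm
    congr 1
    ext i j
    simp
  · intro i _
    simp [h0 (f i) (by simp)]

section
variable {n : ℕ} {π : ℤ ≃ ℤ}

theorem IsJuggling.symm_le (hπ : IsJuggling n π) (i : ℤ) : π.symm i ≤ i := by
  simpa using hπ.le_self (π.symm i)

theorem IsJuggling.le_symm (hπ : IsJuggling n π) (i : ℤ) : i ≤ π.symm i + n := by
  simpa using hπ.le_add (π.symm i)

theorem IsJuggling.symm_per (hπ : IsJuggling n π) (i : ℤ) : π.symm (i + n) = π.symm i + n := by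
  rw [Equiv.symm_apply_eq, hπ.periodic]; simp

theorem dual_apply (i : ℤ) : dualJug n π i = π.symm i + n := rfl

noncomputable def RR (n : ℕ) (π : ℤ ≃ ℤ) (a b : ℤ) : Finset ℤ :=
  (Finset.Icc a b).filter (fun i => b - n < π.symm i)
noncomputable def QQ (n : ℕ) (π : ℤ ≃ ℤ) (a b : ℤ) : Finset ℤ :=
  (Finset.Icc a b).filter (fun j => π j < a + n)

theorem FF (hπ : IsJuggling n π) (C : ℤ → ℤ → K) (hC : IsFrieze n π C) :
    ∀ (m : ℕ) (a b : ℤ), b + 1 = a + m → b < a + n → minor C (RR n π a b) (QQ n π a b) = 1 := by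
  obtain ⟨hP, hFr, -⟩ := hC
  intro m
  induction m with
  | zero =>
    intro a b h1 h2
    have e1 : RR n π a b = ∅ := by
      unfold RR; rw [Finset.Icc_eq_empty (by simp at h1; omega)]; simp
    have e2 : QQ n π a b = ∅ := by
      unfold QQ; rw [Finset.Icc_eq_empty (by simp at h1; omega)]; simp
    rw [e1, e2]
    simp only [minor, Finset.card_empty, ↓reduceDIte]
    exact Matrix.det_isEmpty
  | succ m ih =>
    intro a b h1 h2
    push_cast at h1
    by_cases hA : b < π.symm a + n
    · have := ih (a+1) b (by omega) (by omega)
      have e1 : RR n π a b = insert a (RR n π (a+1) b) := by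
        ext i
        simp only [RR, Finset.mem_insert, Finset.mem_filter, Finset.mem_Icc]
        by_cases hi : i = a
        · subst hi; simp; omega
        · simp [hi]; omega
      have hper := hπ.symm_per a
      have hle := hπ.le_add a
      have e2 : QQ n π a b = insert a (QQ n π (a+1) b) := by
        ext i
        simp only [QQ, Finset.mem_insert, Finset.mem_filter, Finset.mem_Icc]
        have hi2 : i ≤ b → π i ≠ a + n := by
          intro hib h
          rw [← h] at hper
          simp at hper; omega
        by_cases hi : i = a
        · subst hi; simp; omega
        · simp [hi]; omega
      rw [e1, e2]
      refine minor_first C _ _ a this ?_ ?_ ((hP a a).1 rfl) ?_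
      · intro q hq; simp [QQ] at hq; omega
      · intro q hq; simp [RR] at hq; omega
      · intro q hq
        refine (hP a q).2.2 (Or.inl ?_)
        simp [QQ] at hq; omega
    by_cases hB : a + n ≤ π b
    · have := hFr a b (by rw [dual_apply]; omega) h2 hB
      convert this using 2
      · ext i
        simp only [RR, Finset.mem_filter, Finset.mem_Icc, Finset.mem_sdiff]
        simp only [dual_apply]
        omega
      · ext j
        simp only [QQ, Finset.mem_filter, Finset.mem_Icc, Finset.mem_sdiff, Finset.mem_image]
        simp only [dual_apply]
        constructor
        · rintro ⟨hj, hj2⟩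
          refine ⟨hj, ?_⟩
          rintro ⟨i, hi, hij⟩
          have := hπ.symm_per i
          rw [hij, Equiv.symm_apply_eq] at this
          omega
        · rintro ⟨hj, hj2⟩
          refine ⟨hj, ?_⟩
          by_contra hcon
          apply hj2
          have h3 := hπ.symm_per (π j - n)
          have h4 := hπ.le_add j
          simp at h3
          exact ⟨π j - n, by omega, by omega⟩
    · have := ih a (b-1) (by omega) (by omega)
      have hper := hπ.periodic (b-n)
      simp at hper
      have hle := hπ.le_symm b
      have hne : π.symm b ≠ b - n := by
        intro h
        rw [Equiv.symm_apply_eq] at h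
        omega
      have e1 : RR n π a b = insert b (RR n π a (b-1)) := by
        ext i
        simp only [RR, Finset.mem_insert, Finset.mem_filter, Finset.mem_Icc]
        have hi2 : a ≤ i → π.symm i ≠ b - n := by
          intro hib h
          rw [Equiv.symm_apply_eq] at h
          omega
        by_cases hi : i = b
        · subst hi; simp; omega
        · simp [hi]; omega
      have e2 : QQ n π a b = insert b (QQ n π a (b-1)) := by
        ext i
        simp only [QQ, Finset.mem_insert, Finset.mem_filter, Finset.mem_Icc]
        by_cases hi : i = b
        · subst hi; simp; omega
        · simp [hi]; omega
      rw [e1, e2]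
      refine minor_last C _ _ b this ?_ ?_ ((hP b b).1 rfl) ?_
      · intro q hq; simp [QQ] at hq; omega
      · intro q hq; simp [RR] at hq; omega
      · intro q hq
        refine (hP q b).2.2 (Or.inl ?_)
        simp [RR] at hq; omega

theorem exists_sol (C : ℤ → ℤ → K) (h1 : ∀ a, C a a = 1) (a : ℤ) (m : ℕ) :
    ∃ v : ℤ → K, v a = 1 ∧ (∀ c, v c ≠ 0 → a ≤ c ∧ c ≤ a + m) ∧
      ∀ r, a < r → r ≤ a + m → ∑ c ∈ Finset.Icc a r, C r c * v c = 0 := by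
  induction m with
  | zero =>
    refine ⟨Pi.single a 1, by simp, ?_, ?_⟩
    · intro c hc
      by_cases h : c = a
      · subst h; simp
      · simp [h] at hc
    · intro r h2 h3; simp at h3; omega
  | succ m ih =>
    obtain ⟨v, hv1, hv2, hv3⟩ := ih
    refine ⟨Function.update v (a + m + 1)
      (-∑ c ∈ Finset.Icc a (a + m), C (a + m + 1) c * v c), ?_, ?_, ?_⟩
    · rw [Function.update_of_ne (by omega), hv1]
    · intro c hc
      by_cases h : c = a + m + 1
      · subst h; push_cast; omega
      · rw [Function.update_of_ne h] at hc
        have := hv2 c hc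
        push_cast; omega
    · intro r h2 h3
      push_cast at h3
      by_cases h : r = a + m + 1
      · subst h
        have e : Finset.Icc a (a + m + 1) = insert (a + m + 1) (Finset.Icc a (a + m)) := by
          ext x; simp; omega
        rw [e, Finset.sum_insert (by simp), Function.update_self, h1, one_mul, neg_add_eq_zero]
        refine Finset.sum_congr rfl fun c hc => ?_
        simp at hc
        rw [Function.update_of_ne (by omega)]
      · rw [← hv3 r h2 (by omega)]
        refine Finset.sum_congr rfl fun c hc => ?_
        simp at hc
        rw [Function.update_of_ne (by omega)]

theorem column_key (hπ : IsJuggling n π) (C : ℤ → ℤ → K) (hC : IsFrieze n π C) (a : ℤ)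
    (v : ℤ → K) (hv1 : v a = 1) (hv3 : ∀ r, a < r → r < a + n → ∑ c ∈ Finset.Icc a r, C r c * v c = 0)
    (b : ℤ) (hab : a < b) (hb : b < a + n) (hs : ∀ c, a < c → c < b → v c ≠ 0 → π c ≤ a + n) :
    minor C (insert b (RR n π (a+1) (b-1))) (insert a (QQ n π (a+1) (b-1))) =
      (-1) ^ (QQ n π (a+1) (b-1)).card * (-v b) := by
  have hP := hC.1
  have hF := FF hπ C hC (b - 1 - a).toNat (a+1) (b-1) (by omega) (by omega)
  have hsum : ∀ r, a < r → r ≤ b → (∑ c ∈ insert a (QQ n π (a+1) (b-1)), C r c * v c) =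
      ∑ c ∈ Finset.Icc a (b-1), C r c * v c := by
    intro r h1 h2
    apply Finset.sum_subset
    · intro x hx
      simp [QQ] at hx ⊢
      omega
    · intro x hx hx2
      by_contra hne
      have hx3 : v x ≠ 0 := fun h => hne (by rw [h, mul_zero])
      simp [QQ] at hx hx2
      have := hs x (by omega) (by omega) hx3
      omega
  apply minor_cramer C _ _ a b hF
  · intro q hq; simp [QQ] at hq; omega
  · intro q hq; simp [RR] at hq; omega
  · exact hv1
  · intro r hr
    simp [RR] at hr
    rw [hsum r (by omega) (by omega), ← hv3 r (by omega) (by omega)]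
    symm
    apply Finset.sum_subset
    · intro x hx
      simp at hx ⊢
      omega
    · intro x hx hx2
      simp at hx hx2
      rw [(hP r x).2.2 (Or.inl (by omega)), zero_mul]
  · rw [hsum b hab le_rfl]
    have := hv3 b hab hb
    have e : Finset.Icc a b = insert b (Finset.Icc a (b-1)) := by
      ext x; simp; omega
    rw [e, Finset.sum_insert (by simp), (hP b b).1 rfl] at this
    linear_combination this

theorem column_supp (hπ : IsJuggling n π) (C : ℤ → ℤ → K) (hC : IsFrieze n π C) (a : ℤ)
    (v : ℤ → K) (hv1 : v a = 1) (hv3 : ∀ r, a < r → r < a + n → ∑ c ∈ Finset.Icc a r, C r c * v c = 0)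
    (m : ℕ) : ∀ b, b = a + m → b < a + n → v b ≠ 0 → π b ≤ a + n ∧ b ≤ π.symm a + n := by
  induction m using Nat.strong_induction_on with
  | _ m ih =>
    intro b hm hb hvb
    by_cases hab : a = b
    · subst hab
      exact ⟨hπ.le_add a, hπ.le_symm a⟩
    have hab' : a < b := by omega
    have key := column_key hπ C hC a v hv1 hv3 b hab' hb (fun c h1 h2 h3 =>
      (ih (c - a).toNat (by omega) c (by omega) (by omega) h3).1)
    by_contra hcon
    have ht := hC.2.2 a b (by rw [dual_apply]; omega)
    have : minor C (insert b (RR n π (a+1) (b-1))) (insert a (QQ n π (a+1) (b-1))) = 0 := by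
      rw [← ht]
      congr 1
      · ext i
        simp only [RR, Finset.mem_filter, Finset.mem_Icc, Finset.mem_sdiff, Finset.mem_insert,
          Finset.mem_Ioc, Finset.mem_Ioo]
        simp only [dual_apply]
        have := hπ.le_symm b
        by_cases hi : i = b
        · subst hi; simp; omega
        · simp only [hi, false_or]; omega
      · ext j
        simp only [QQ, Finset.mem_filter, Finset.mem_Icc, Finset.mem_sdiff, Finset.mem_image,
          Finset.mem_insert, Finset.mem_Ico, Finset.mem_Ioo]
        simp only [dual_apply]
        have hja : j = a → π j ≤ a + n := by
          rintro rfl; exact hπ.le_add j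
        constructor
        · intro hj
          refine ⟨by omega, ?_⟩
          rintro ⟨i, hi, hij⟩
          have := hπ.symm_per i
          rw [hij, Equiv.symm_apply_eq] at this
          omega
        · rintro ⟨hj, hj2⟩
          by_contra hcon
          apply hj2
          have h3 := hπ.symm_per (π j - n)
          have h4 := hπ.le_add j
          simp at h3
          exact ⟨π j - n, by omega, by omega⟩
    rw [key] at this
    simp at this
    exact hvb this

theorem column_val (hπ : IsJuggling n π) (C : ℤ → ℤ → K) (hC : IsFrieze n π C) (a : ℤ)
    (v : ℤ → K) (hv1 : v a = 1) (hv3 : ∀ r, a < r → r < a + n → ∑ c ∈ Finset.Icc a r, C r c * v c = 0)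
    (b : ℤ) (hab : a < b) (hb : b < a + n) (hb2 : b = π.symm a + n) :
      (-1) ^ (QQ n π (a+1) (b-1)).card * (-v b) = 1 := by
  have key := column_key hπ C hC a v hv1 hv3 b hab hb (fun c h1 h2 h3 =>
      (column_supp hπ C hC a v hv1 hv3 (c - a).toNat c (by omega) (by omega) h3).1)
  rw [← key, ← FF hπ C hC (b + 1 - a).toNat a b (by omega) (by omega)]
  have hpb : π b = a + n := by
    rw [hb2, hπ.periodic]; simp
  congr 1
  · ext i
    simp only [RR, Finset.mem_filter, Finset.mem_Icc, Finset.mem_insert]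
    have hi2 : π.symm i = b - n → i = a := by
      intro h
      have : π.symm i = π.symm a := by omega
      simpa using this
    have hi3 : i = a → π.symm i = b - n := by rintro rfl; omega
    have hi4 : i = b → b - n < π.symm i := by
      rintro rfl
      have := hπ.le_symm i
      by_contra hcon
      have := hi2 (by omega)
      omega
    by_cases hi : i = b
    · simp [hi] at hi4 ⊢; omega
    · simp only [hi, false_or]; omega
  · ext j
    simp only [QQ, Finset.mem_filter, Finset.mem_Icc, Finset.mem_insert]
    have hj2 : π j = a + n → j = b := by
      intro h
      rw [← hpb] at h
      simpa using h
    have hj3 : j = b → π j = a + n := by rintro rfl; exact hpb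
    have hj4 : j = a → π j ≤ a + n := by rintro rfl; exact hπ.le_add j
    omega

theorem card_QQ_succ (hπ : IsJuggling n π) (a : ℤ) :
    (QQ n π a (a + n)).card = (QQ n π (a+1) (a + 1 + n)).card := by
  have hc : π (π.symm a + n) = a + n := by rw [hπ.periodic]; simp
  have hcj : ∀ j, π j = a + n → j = π.symm a + n := by
    intro j h; rw [← hc] at h; simpa using h
  have h1 := hπ.le_add a
  have h2 := hπ.symm_le a
  have h3 := hπ.le_symm a
  have hn := hπ.npos
  by_cases h : π a = a + n
  · congr 1
    have := hcj a h
    ext j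
    simp only [QQ, Finset.mem_filter, Finset.mem_Icc]
    have h4 := hcj j
    have h5 := hπ.le_self j
    have h6 : j = a → π j = a + n := by rintro rfl; exact h
    omega
  · have hne : π.symm a + n ≠ a := by
      intro h'; rw [h'] at hc; exact h hc
    have e1 : QQ n π a (a + n) =
        insert a ((Finset.Icc (a+1) (a+n)).filter (fun j => π j < a + n)) := by
      ext j
      simp only [QQ, Finset.mem_filter, Finset.mem_Icc, Finset.mem_insert]
      have h6 : j = a → π j < a + n := by rintro rfl; omega
      omega
    have e2 : QQ n π (a+1) (a + 1 + n) = insert (π.symm a + n)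
        ((Finset.Icc (a+1) (a+n)).filter (fun j => π j < a + n)) := by
      ext j
      simp only [QQ, Finset.mem_filter, Finset.mem_Icc, Finset.mem_insert]
      have h4 := hcj j
      have h5 := hπ.le_self j
      have h6 : j = π.symm a + n → π j = a + n := by rintro rfl; exact hc
      omega
    rw [e1, e2, Finset.card_insert_of_notMem (by simp),
      Finset.card_insert_of_notMem (by simp [hc])]

theorem card_QQ (hπ : IsJuggling n π) (a : ℤ) :
    (QQ n π a (a + n)).card = (QQ n π 0 (0 + n)).card := by
  induction a using Int.induction_on with
  | zero => rfl
  | succ i ih => rw [← ih]; exact (card_QQ_succ hπ i).symm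
  | pred i ih => rw [← ih, card_QQ_succ hπ]; simp

theorem column (hπ : IsJuggling n π) (C : ℤ → ℤ → K) (hC : IsFrieze n π C) (a : ℤ) :
    ∃ v : ℤ → K, (∀ c, v c ≠ 0 → a ≤ c ∧ c ≤ π.symm a + n) ∧
      ∀ r, ∑ c ∈ Finset.Icc a (a + n), C r c * v c =
        (if r = a then 1 else 0) + (if r = a + n then (-1) ^ (QQ n π 0 (0 + n)).card else 0) := by
  have hP := hC.1
  have hn := hπ.npos
  obtain ⟨v, hv1, hv2, hv3⟩ := exists_sol C (fun a => (hP a a).1 rfl) a (n - 1)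
  have hv3' : ∀ r, a < r → r < a + n → ∑ c ∈ Finset.Icc a r, C r c * v c = 0 :=
    fun r h1 h2 => hv3 r h1 (by omega)
  have hs : ∀ c, v c ≠ 0 → a ≤ c ∧ c < a + n ∧ π c ≤ a + n ∧ c ≤ π.symm a + n := by
    intro c hc
    have h1 := hv2 c hc
    have := column_supp hπ C hC a v hv1 hv3' (c - a).toNat c (by omega) (by omega) hc
    omega
  have hlow : ∀ r, r < a + n → ∑ c ∈ Finset.Icc a (a + n), C r c * v c = if r = a then 1 else 0 := by
    intro r hr
    by_cases hra : r < a
    · rw [if_neg (by omega)]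
      apply Finset.sum_eq_zero
      intro c hc
      simp at hc
      rw [(hP r c).2.2 (Or.inl (by omega)), zero_mul]
    have e : ∑ c ∈ Finset.Icc a (a + n), C r c * v c = ∑ c ∈ Finset.Icc a r, C r c * v c := by
      symm
      apply Finset.sum_subset
      · intro x hx
        simp at hx ⊢
        omega
      · intro x hx hx2
        simp at hx hx2
        rw [(hP r x).2.2 (Or.inl (by omega)), zero_mul]
    rw [e]
    split_ifs with h
    · subst h
      simp [hv1, (hP r r).1 rfl]
    · exact hv3' r (by omega) hr
  have hhigh : ∀ r, a + n < r → ∑ c ∈ Finset.Icc a (a + n), C r c * v c = 0 := by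
    intro r hr
    apply Finset.sum_eq_zero
    intro c hc
    by_cases h : v c = 0
    · rw [h, mul_zero]
    · have := hs c h
      rw [(hP r c).2.2 (Or.inl (by omega)), zero_mul]
  have hc : π (π.symm a + n) = a + n := by rw [hπ.periodic]; simp
  have hcj : ∀ j, π j = a + n → j = π.symm a + n := by
    intro j h; rw [← hc] at h; simpa using h
  have h2 := hπ.symm_le a
  have h3 := hπ.le_symm a
  have hmid : ∑ c ∈ Finset.Icc a (a + n), C (a + n) c * v c =
      C (a + n) (π.symm a + n) * v (π.symm a + n) := by
    apply Finset.sum_eq_single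
    · intro c hc hne
      by_cases h : v c = 0
      · rw [h, mul_zero]
      · have := hs c h
        have := hcj c
        rw [(hP (a+n) c).2.2 (Or.inl (by omega)), zero_mul]
    · intro h
      simp at h
      omega
  by_cases hfix : π.symm a = a
  · have hva : v (a + n) = 0 := by
      by_contra h
      have := hs _ h
      omega
    rw [hfix] at hc hmid
    refine ⟨fun c => v c + if c = a + n then (-1) ^ (QQ n π 0 (0 + n)).card else 0, ?_, ?_⟩
    · intro c hc
      by_cases h : c = a + n
      · omega
      · simp [h] at hc
        have := hs c hc
        omega
    · intro r
      have : ∑ c ∈ Finset.Icc a (a + n), C r c *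
          (v c + if c = a + n then (-1) ^ (QQ n π 0 (0 + n)).card else 0) =
          ∑ c ∈ Finset.Icc a (a + n), C r c * v c + C r (a + n) * (-1) ^ (QQ n π 0 (0 + n)).card := by
        simp [mul_add, Finset.sum_add_distrib]
      rw [this]
      rcases lt_trichotomy r (a + n) with h | h | h
      · rw [hlow r h, (hP r (a + n)).2.2 (Or.inl (by omega))]
        simp [h.ne]
      · rw [h, hmid, hva, (hP (a + n) (a+n)).1 rfl]
        simp; omega
      · rw [hhigh r h, (hP r (a + n)).2.2 (Or.inl (by omega)), if_neg (by omega), if_neg (by omega)]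
        simp
  · refine ⟨v, fun c h => ⟨(hs c h).1, (hs c h).2.2.2⟩, ?_⟩
    intro r
    rcases lt_trichotomy r (a + n) with h | h | h
    · rw [hlow r h]
      simp [h.ne]
    · rw [h, hmid, if_neg (by omega), if_pos rfl, zero_add, (hP (a+n) (π.symm a + n)).2.1 hc.symm,
        ← card_QQ hπ a]
      set c := π.symm a + n with hcdef
      let S : Finset ℤ := (Finset.Icc c (a + n)).filter (fun i => c < i ∧ π i < a + n)
      have hS : {i : ℤ | c < i ∧ π i < a + n} = (S : Set ℤ) := by
        ext i
        have := hπ.le_self i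
        simp [S]
        omega
      rw [hS, Set.ncard_coe_finset]
      by_cases hca : c = a
      · have : S = QQ n π a (a + n) := by
          ext i
          simp only [S, QQ, Finset.mem_filter, Finset.mem_Icc]
          have h6 : i = a → π i = a + n := by rintro rfl; rw [← hca]; exact hca ▸ hc
          omega
        rw [this, hca, hv1, mul_one]
      · have hval := column_val hπ C hC a v hv1 hv3' c (by omega) (by omega) hcdef
        have hna : π a ≠ a + n := fun h => hca (hcj a h).symm
        have hla := hπ.le_add a
        have e : QQ n π a (a + n) = S ∪ insert a (QQ n π (a+1) (c-1)) := by
          ext i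
          simp only [S, QQ, Finset.mem_filter, Finset.mem_Icc, Finset.mem_union, Finset.mem_insert]
          have h6 : i = a → π i < a + n := by rintro rfl; omega
          have h7 : i = c → π i = a + n := by rintro rfl; exact hc
          have h8 := hcj i
          omega
        rw [e, Finset.card_union_of_disjoint, Finset.card_insert_of_notMem (by simp [QQ])]
        · have h9 : ((-1 : K) ^ (QQ n π (a+1) (c-1)).card) * (-1) ^ (QQ n π (a+1) (c-1)).card = 1 := by
            rw [← mul_pow]; simp
          rw [pow_add, pow_succ]
          linear_combination (-1 : K) ^ S.card * (-(-1 : K) ^ (QQ n π (a+1) (c-1)).card * hval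
            - v c * h9)
        · rw [Finset.disjoint_left]
          intro x hx hx2
          simp [S, QQ] at hx hx2
          omega
    · rw [hhigh r h, if_neg (by omega), if_neg (by omega), zero_add]

end

/-- **Periodicity of juggler's friezes.** If `π` is a juggling function of period `n`
and `C` is a `π`-frieze over a field `K`, then `C a b = C (a+n) (b+n)` for all `a b`. -/
theorem frieze_periodic (n : ℕ) (π : ℤ ≃ ℤ) (hπ : IsJuggling n π)
    (C : ℤ → ℤ → K) (hC : IsFrieze n π C) :
    ∀ a b : ℤ, C a b = C (a + n) (b + n) := by
  have hP := hC.1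
  have hn := hπ.npos
  choose N hN1 hN2 using column hπ C hC
  set ε : K := (-1) ^ (QQ n π 0 (0 + n)).card with hε
  have hε0 : ε ≠ 0 := by rw [hε]; exact pow_ne_zero _ (by simp)
  intro a b
  let X : ℤ → K := fun c => (∑ j ∈ Finset.Icc b (b + n), N j c * C j b)
    - (if c = b then 1 else 0) - (if c = b + n then ε else 0)
  have hX : ∀ c, X c ≠ 0 → b ≤ c ∧ c ≤ b + n := by
    intro c hc
    by_contra hcon
    apply hc
    simp only [X]
    rw [if_neg (by omega), if_neg (by omega), Finset.sum_eq_zero]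
    · simp
    · intro j hj
      by_contra hne
      have h1 := hN1 j c (left_ne_zero_of_mul hne)
      have h2 : ¬ _ := fun h => right_ne_zero_of_mul hne ((hP j b).2.2 h)
      omega
  have hY : ∀ r, ∑ c ∈ Finset.Icc b (b + 2 * n), C r c * X c =
      ε * (C (r - n) b - C r (b + n)) := by
    intro r
    have e1 : ∀ j ∈ Finset.Icc b (b + n), ∑ c ∈ Finset.Icc b (b + 2 * n), C r c * (N j c * C j b) =
        ((if r = j then 1 else 0) + (if r = j + n then ε else 0)) * C j b := by
      intro j hj
      simp at hj
      rw [← hN2 j r, Finset.sum_mul]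
      symm
      refine (Finset.sum_subset ?_ ?_).trans (Finset.sum_congr rfl fun c _ => by ring)
      · intro x hx
        simp at hx ⊢
        omega
      · intro x hx hx2
        have : N j x = 0 := by
          by_contra h
          have := hN1 j x h
          have := hπ.symm_le j
          simp at hx hx2
          omega
        rw [this]; ring
    have e2 : ∑ j ∈ Finset.Icc b (b + n),
        ((if r = j then 1 else 0) + (if r = j + n then ε else 0)) * C j b =
        C r b + ε * C (r - n) b := by
      have z : ∀ r, r ∉ Finset.Icc b (b + n) → C r b = 0 := by
        intro r hr
        apply (hP r b).2.2 (Or.inl _)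
        have := hπ.le_add b
        simp at hr
        omega
      have hiff : ∀ j : ℤ, r = j + n ↔ r - n = j := fun j => by omega
      simp only [add_mul, Finset.sum_add_distrib, ite_mul, zero_mul, one_mul, hiff,
        Finset.sum_ite_eq]
      congr 1
      · split_ifs with h
        · rfl
        · exact (z _ h).symm
      · split_ifs with h
        · rfl
        · rw [z _ h, mul_zero]
    have e3 : ∑ c ∈ Finset.Icc b (b + 2 * n), C r c * X c =
        (∑ j ∈ Finset.Icc b (b + n), ∑ c ∈ Finset.Icc b (b + 2 * n), C r c * (N j c * C j b))
        - C r b - ε * C r (b + n) := by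
      rw [Finset.sum_comm]
      simp only [X, mul_sub, Finset.sum_sub_distrib, Finset.mul_sum]
      congr 1
      · congr 1
        simp
      · simp [mul_comm]
        omega
    rw [e3, Finset.sum_congr rfl e1, e2]
    ring
  have hX0 : ∀ m : ℕ, ∀ c, c = b + m → X c = 0 := by
    intro m
    induction m using Nat.strong_induction_on with
    | _ m ih =>
      intro c hc
      by_contra hne
      have h1 := hX c hne
      have h2 := hY c
      rw [Finset.sum_eq_single c] at h2
      · rw [(hP c c).1 rfl, one_mul] at h2
        apply hne
        rw [h2]
        by_cases h : c = b + n
        · rw [h, (hP (b+n) (b+n)).1 rfl, (hP (b+n-n) b).1 (by ring)]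
          simp
        · rw [(hP (c - n) b).2.2 (Or.inl (by omega)), (hP c (b + n)).2.2 (Or.inl (by omega))]
          simp
      · intro d hd hdc
        simp at hd
        rcases lt_or_gt_of_ne hdc with h | h
        · rw [ih (d - b).toNat (by omega) d (by omega), mul_zero]
        · rw [(hP c d).2.2 (Or.inl (by omega)), zero_mul]
      · intro h
        simp at h
        omega
  have h := hY (a + n)
  rw [Finset.sum_eq_zero] at h
  · have h' := (mul_eq_zero.1 h.symm).resolve_left hε0
    rw [add_sub_cancel_right] at h'
    exact sub_eq_zero.1 h'
  · intro c hc
    simp at hc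
    rw [hX0 (c - b).toNat c (by omega), mul_zero]
end

section
/- Let π be a juggling function of period n with h balls and let C be a π-prefrieze over a field 𝕜. Then C is a π-frieze if and only if every sequence x : ℤ → 𝕜 with Cx = 0 satisfies x_{a+n} = (−1)^{n−h−1}·x_a for all a ∈ ℤ. -/
open Finset

variable {K : Type*} [Field K]

/-- The sequence `x : ℤ → K` solves the linear recurrence `C x = 0`:
each row of `C` has finitely many nonzero entries, and the (finite) sum
`∑_b C a b * x b` vanishes for every `a`. -/
def SolvesRec (C : ℤ → ℤ → K) (x : ℤ → K) : Prop :=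
  ∀ a : ℤ, ∑ᶠ b : ℤ, C a b * x b = 0


namespace JF

lemma minor_eq (F : ℤ → ℤ → K) (R Q : Finset ℤ) (k : ℕ) (hR : R.card = k) (hQ : Q.card = k) :
    minor F R Q = Matrix.det (Matrix.of fun i j : Fin k =>
      F (R.orderEmbOfFin hR i) (Q.orderEmbOfFin hQ j)) := by
  subst hR
  simp [minor, hQ]

lemma minor_congr (F F' : ℤ → ℤ → K) (R Q : Finset ℤ) (h : ∀ p ∈ R, ∀ q ∈ Q, F p q = F' p q) :
    minor F R Q = minor F' R Q := by
  unfold minor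
  split_ifs with hc
  · congr 1
    ext i j
    exact h _ (Finset.orderEmbOfFin_mem _ _ _) _ (Finset.orderEmbOfFin_mem _ _ _)
  · rfl

lemma card_lt_orderEmb (R : Finset ℤ) (k : ℕ) (hR : R.card = k) (i : Fin k) :
    (R.filter (fun r => r < R.orderEmbOfFin hR i)).card = i := by
  have : R.filter (fun r => r < R.orderEmbOfFin hR i)
      = (Finset.Iio i).map (R.orderEmbOfFin hR).toEmbedding := by
    ext x
    simp only [Finset.mem_filter, Finset.mem_map, Finset.mem_Iio]
    constructor
    · rintro ⟨hx, hlt⟩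
      have : x ∈ Set.range (R.orderEmbOfFin hR) := by
        rw [Finset.range_orderEmbOfFin]; exact hx
      obtain ⟨y, rfl⟩ := this
      exact ⟨y, by simpa using hlt, rfl⟩
    · rintro ⟨y, hy, rfl⟩
      exact ⟨Finset.orderEmbOfFin_mem _ _ _, by simpa using hy⟩
  rw [this, Finset.card_map, Fin.card_Iio]

lemma orderEmb_erase (R : Finset ℤ) (k : ℕ) (hR : R.card = k + 1) (i : Fin (k + 1))
    (h' : (R.erase (R.orderEmbOfFin hR i)).card = k) (x : Fin k) :
    (R.erase (R.orderEmbOfFin hR i)).orderEmbOfFin h' x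
      = R.orderEmbOfFin hR (i.succAbove x) := by
  have := Finset.orderEmbOfFin_unique h' (f := fun x => R.orderEmbOfFin hR (i.succAbove x))
    (by
      intro x
      rw [Finset.mem_erase]
      refine ⟨?_, Finset.orderEmbOfFin_mem _ _ _⟩
      intro h
      exact Fin.succAbove_ne i x ((R.orderEmbOfFin hR).injective h))
    (by
      intro x y hxy
      exact (R.orderEmbOfFin hR).strictMono (Fin.strictMono_succAbove i hxy))
  exact (congrFun this x).symm

lemma minor_laplace_col (F : ℤ → ℤ → K) (R Q : Finset ℤ) (r q : ℤ) (hr : r ∈ R) (hq : q ∈ Q)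
    (h : ∀ p ∈ R, p ≠ r → F p q = 0) :
    minor F R Q = (-1) ^ ((R.filter (· < r)).card + (Q.filter (· < q)).card) * F r q
      * minor F (R.erase r) (Q.erase q) := by
  by_cases hc : Q.card = R.card
  · obtain ⟨k, hk⟩ : ∃ k, R.card = k + 1 :=
      ⟨R.card - 1, by have := Finset.card_pos.2 ⟨r, hr⟩; omega⟩
    have hk' : Q.card = k + 1 := by omega
    obtain ⟨i, rfl⟩ : r ∈ Set.range (R.orderEmbOfFin hk) := by
      rw [Finset.range_orderEmbOfFin]; exact hr
    obtain ⟨j, rfl⟩ : q ∈ Set.range (Q.orderEmbOfFin hk') := by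
      rw [Finset.range_orderEmbOfFin]; exact hq
    have e1 : (R.erase (R.orderEmbOfFin hk i)).card = k := by
      rw [Finset.card_erase_of_mem hr]; omega
    have e2 : (Q.erase (Q.orderEmbOfFin hk' j)).card = k := by
      rw [Finset.card_erase_of_mem hq]; omega
    rw [minor_eq F R Q (k+1) hk hk', minor_eq F _ _ k e1 e2, Matrix.det_succ_column _ j,
      Finset.sum_eq_single i, card_lt_orderEmb, card_lt_orderEmb]
    · congr 2
      ext x y
      simp only [Matrix.of_apply, Matrix.submatrix_apply]
      rw [orderEmb_erase, orderEmb_erase]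
    · intro b _ hb
      rw [Matrix.of_apply, h _ (Finset.orderEmbOfFin_mem _ _ _)]
      · simp
      · intro hh; exact hb ((R.orderEmbOfFin hk).injective hh)
    · simp
  · have h1 : minor F R Q = 0 := by simp [minor, hc]
    have h2 : minor F (R.erase r) (Q.erase q) = 0 := by
      unfold minor
      rw [dif_neg]
      rw [Finset.card_erase_of_mem hr, Finset.card_erase_of_mem hq]
      have := Finset.card_pos.2 ⟨r, hr⟩
      have := Finset.card_pos.2 ⟨q, hq⟩
      omega
    rw [h1, h2, mul_zero]

lemma minor_transpose (F : ℤ → ℤ → K) (R Q : Finset ℤ) :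
    minor F R Q = minor (fun a b => F b a) Q R := by
  by_cases hc : Q.card = R.card
  · rw [minor_eq F R Q R.card rfl hc, minor_eq _ Q R R.card hc rfl, ← Matrix.det_transpose]
    rfl
  · have h1 : minor F R Q = 0 := by simp [minor, hc]
    rw [h1]
    simp [minor, Ne.symm hc]

lemma minor_laplace_row (F : ℤ → ℤ → K) (R Q : Finset ℤ) (r q : ℤ) (hr : r ∈ R) (hq : q ∈ Q)
    (h : ∀ p ∈ Q, p ≠ q → F r p = 0) :
    minor F R Q = (-1) ^ ((R.filter (· < r)).card + (Q.filter (· < q)).card) * F r q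
      * minor F (R.erase r) (Q.erase q) := by
  rw [minor_transpose, minor_laplace_col _ Q R q r hq hr h, minor_transpose F, add_comm]

lemma minor_self (F : ℤ → ℤ → K) (S : Finset ℤ) :
    minor F S S = Matrix.det (Matrix.of fun i j : S => F i j) := by
  rw [minor_eq F S S S.card rfl rfl,
    ← Matrix.det_submatrix_equiv_self (S.orderIsoOfFin rfl).toEquiv]
  rfl

lemma minor_empty (F : ℤ → ℤ → K) : minor F ∅ ∅ = 1 := by
  rw [minor_self]; simp

lemma minor_image (F : ℤ → ℤ → K) (τ : ℤ ≃ ℤ) (S : Finset ℤ) :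
    minor F (S.image τ) (S.image τ) = minor (fun a b => F (τ a) (τ b)) S S := by
  rw [minor_self, minor_self]
  let e : S ≃ (S.image τ : Finset ℤ) :=
    { toFun := fun s => ⟨τ s, Finset.mem_image_of_mem _ s.2⟩
      invFun := fun s => ⟨τ.symm s, by
        obtain ⟨y, hy, h⟩ := Finset.mem_image.1 s.2
        rw [← h]; simpa using hy⟩
      left_inv := fun s => by simp
      right_inv := fun s => by simp }
  rw [← Matrix.det_submatrix_equiv_self e]
  rfl

lemma minor_mul (F G H : ℤ → ℤ → K) (S : Finset ℤ)
    (h : ∀ p ∈ S, ∀ q ∈ S, F p q = ∑ c ∈ S, G p c * H c q) :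
    minor F S S = minor G S S * minor H S S := by
  rw [minor_self, minor_self, minor_self, ← Matrix.det_mul]
  congr 1
  ext i j
  rw [Matrix.mul_apply, Matrix.of_apply, h i i.2 j j.2]
  simp only [Matrix.of_apply]
  rw [← Finset.sum_coe_sort S]

lemma minor_upper (F : ℤ → ℤ → K) (S : Finset ℤ)
    (h : ∀ p ∈ S, ∀ q ∈ S, q < p → F p q = 0) :
    minor F S S = ∏ p ∈ S, F p p := by
  rw [minor_self, Matrix.det_of_isUpperTriangular, ← Finset.prod_coe_sort S]
  · rfl
  · intro i j hij
    exact h i i.2 j j.2 hij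

lemma minor_lower (F : ℤ → ℤ → K) (S : Finset ℤ)
    (h : ∀ p ∈ S, ∀ q ∈ S, p < q → F p q = 0) :
    minor F S S = ∏ p ∈ S, F p p := by
  rw [minor_transpose, minor_upper]
  intro p hp q hq hqp
  exact h q hq p hp hqp

/-- remove unit columns, diagonal version -/
lemma minor_remove_diag (F : ℤ → ℤ → K) (S T : Finset ℤ) (hT : T ⊆ S)
    (h : ∀ q ∈ T, ∀ p ∈ S, F p q = if p = q then 1 else 0) :
    minor F S S = minor F (S \ T) (S \ T) := by
  induction T using Finset.induction_on with
  | empty => simp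
  | insert t T ht ih =>
    have htS : t ∈ S := hT (Finset.mem_insert_self _ _)
    rw [ih (fun x hx => hT (Finset.mem_insert_of_mem hx))
      (fun q hq => h q (Finset.mem_insert_of_mem hq))]
    have hmem : t ∈ S \ T := Finset.mem_sdiff.2 ⟨htS, ht⟩
    rw [minor_laplace_col F (S \ T) (S \ T) t t hmem hmem]
    · rw [h t (Finset.mem_insert_self _ _) t htS, if_pos rfl, ← two_mul, pow_mul]
      have : (S \ T).erase t = S \ insert t T := by
        ext x; simp; tauto
      rw [this]; simp
    · intro p hp hpt
      rw [h t (Finset.mem_insert_self _ _) p (Finset.mem_sdiff.1 hp).1, if_neg hpt]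

/-- sign attached to `i` -/
noncomputable def sg (a b : ℤ) (I : Finset ℤ) (τ : ℤ ≃ ℤ) (i : ℤ) : ℕ :=
  ((Finset.Icc a b).filter (· < i)).card +
    ((Finset.Icc a b \ (I.filter (fun j => i < j)).image τ).filter (· < τ i)).card

lemma minor_remove (F : ℤ → ℤ → K) (a b : ℤ) (τ : ℤ ≃ ℤ) (I : Finset ℤ)
    (hI : I ⊆ Finset.Icc a b) (hτ : ∀ i ∈ I, τ i ∈ Finset.Icc a b)
    (h : ∀ i ∈ I, ∀ p ∈ Finset.Icc a b, F p (τ i) = if p = i then 1 else 0) :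
    minor F (Finset.Icc a b) (Finset.Icc a b) = (∏ i ∈ I, (-1 : K) ^ sg a b I τ i) *
      minor F (Finset.Icc a b \ I) (Finset.Icc a b \ I.image τ) := by
  induction I using Finset.induction_on_min with
  | empty => simp
  | insert i I hlt ih =>
    have hiI : i ∉ I := fun hi => lt_irrefl _ (hlt i hi)
    have hi : i ∈ Finset.Icc a b := hI (Finset.mem_insert_self _ _)
    have hti := hτ i (Finset.mem_insert_self _ _)
    rw [ih (fun x hx => hI (Finset.mem_insert_of_mem hx))
      (fun q hq => hτ q (Finset.mem_insert_of_mem hq))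
      (fun q hq => h q (Finset.mem_insert_of_mem hq))]
    have m1 : i ∈ Finset.Icc a b \ I := Finset.mem_sdiff.2 ⟨hi, hiI⟩
    have m2 : τ i ∈ Finset.Icc a b \ I.image τ := by
      refine Finset.mem_sdiff.2 ⟨hti, ?_⟩
      simpa using hiI
    rw [minor_laplace_col F _ _ i (τ i) m1 m2]
    · rw [h i (Finset.mem_insert_self _ _) i hi, if_pos rfl]
      have e1 : (Finset.Icc a b \ I).erase i = Finset.Icc a b \ insert i I := by
        ext x; simp; tauto
      have e2 : (Finset.Icc a b \ I.image τ).erase (τ i)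
          = Finset.Icc a b \ (insert i I).image τ := by
        ext x; simp; tauto
      rw [e1, e2, Finset.prod_insert hiI]
      have e3 : sg a b (insert i I) τ i = ((Finset.Icc a b \ I).filter (· < i)).card
          + ((Finset.Icc a b \ I.image τ).filter (· < τ i)).card := by
        unfold sg
        congr 2
        · ext x
          simp only [Finset.mem_filter, Finset.mem_sdiff]
          constructor
          · rintro ⟨h1, h2⟩
            exact ⟨⟨h1, fun h3 => absurd (hlt x h3) (by omega)⟩, h2⟩
          · rintro ⟨⟨h1, _⟩, h2⟩; exact ⟨h1, h2⟩
        · have : (insert i I).filter (fun j => i < j) = I := by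
            ext x
            simp only [Finset.mem_filter, Finset.mem_insert]
            constructor
            · rintro ⟨rfl | h1, h2⟩
              · omega
              · exact h1
            · intro hx; exact ⟨Or.inr hx, hlt x hx⟩
          rw [this]
      have e4 : ∀ x ∈ I, sg a b (insert i I) τ x = sg a b I τ x := by
        intro x hx
        unfold sg
        have : (insert i I).filter (fun j => x < j) = I.filter (fun j => x < j) := by
          rw [Finset.filter_insert, if_neg]
          have := hlt x hx
          omega
        rw [this]
      rw [e3, Finset.prod_congr rfl (fun x hx => congrArg (fun t => (-1 : K) ^ t) (e4 x hx))]
      ring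
    · intro p hp hpi
      rw [h i (Finset.mem_insert_self _ _) p (Finset.mem_sdiff.1 hp).1, if_neg hpi]

/-- Key lemma: complementary minors. -/
lemma key (C D : ℤ → ℤ → K) (a b : ℤ) (τ : ℤ ≃ ℤ) (I : Finset ℤ)
    (hI : I ⊆ Finset.Icc a b) (hτ : ∀ i ∈ I, τ i ∈ Finset.Icc a b)
    (hdiag : ∀ p, C p p = 1) (htri : ∀ p q, p < q → C p q = 0)
    (hD : ∀ p ∈ Finset.Icc a b, ∀ i ∈ Finset.Icc a b,
      ∑ c ∈ Finset.Icc a b, C p c * D c i = if p = i then 1 else 0) :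
    minor (fun i' i => D (τ i') i) I I = (∏ i ∈ I, (-1 : K) ^ sg a b I τ i) *
      minor C (Finset.Icc a b \ I) (Finset.Icc a b \ I.image τ) := by
  let M : ℤ → ℤ → K := fun p q =>
    if τ.symm q ∈ I then (if p = τ.symm q then 1 else 0) else C p q
  let N : ℤ → ℤ → K := fun p q =>
    if τ.symm q ∈ I then D p (τ.symm q) else (if p = q then 1 else 0)
  have h1 : minor M (Finset.Icc a b) (Finset.Icc a b)
      = minor C (Finset.Icc a b) (Finset.Icc a b) * minor N (Finset.Icc a b) (Finset.Icc a b) := by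
    apply minor_mul
    intro p hp q hq
    by_cases hqI : τ.symm q ∈ I
    · simp only [M, N, hqI, if_true]
      rw [hD p hp _ (hI hqI)]
    · simp only [M, N, hqI, if_false]
      simp [hq]
  have h2 : minor C (Finset.Icc a b) (Finset.Icc a b) = 1 := by
    rw [minor_lower _ _ (fun p _ q _ h => htri p q h)]
    simp [hdiag]
  have h3 := minor_remove M a b τ I hI hτ (by
    intro i hi p hp
    simp [M, hi])
  have h4 : minor M (Finset.Icc a b \ I) (Finset.Icc a b \ I.image τ)
      = minor C (Finset.Icc a b \ I) (Finset.Icc a b \ I.image τ) := by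
    apply minor_congr
    intro p _ q hq
    have : τ.symm q ∉ I := by
      intro h
      exact (Finset.mem_sdiff.1 hq).2 (Finset.mem_image.2 ⟨_, h, by simp⟩)
    simp [M, this]
  have hsub : I.image τ ⊆ Finset.Icc a b := by
    intro x hx
    obtain ⟨y, hy, rfl⟩ := Finset.mem_image.1 hx
    exact hτ y hy
  have h5 := minor_remove_diag N (Finset.Icc a b) (Finset.Icc a b \ I.image τ)
    Finset.sdiff_subset (by
      intro q hq p _
      have : τ.symm q ∉ I := by
        intro h
        exact (Finset.mem_sdiff.1 hq).2 (Finset.mem_image.2 ⟨_, h, by simp⟩)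
      simp [N, this])
  rw [Finset.sdiff_sdiff_eq_self hsub, minor_image] at h5
  have h6 : minor (fun i' i => D (τ i') i) I I = minor (fun a b => N (τ a) (τ b)) I I := by
    apply minor_congr
    intro p _ q hq
    simp [N, hq]
  rw [h6, ← h5, ← h4, ← h3, h1, h2, one_mul]

/-! columns of inverses -/

noncomputable def zrec (L : ℤ → ℤ → K) (i : ℤ) : ℕ → K
  | m => ((if m = 0 then 1 else 0) - ∑ k : Fin m, L (i + m) (i + k) * zrec L i k) / L (i + m) (i + m)
decreasing_by exact k.2

lemma exists_col (L : ℤ → ℤ → K) (hdiag : ∀ a, L a a ≠ 0) (htri : ∀ a b, a < b → L a b = 0)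
    (i : ℤ) : ∃ x : ℤ → K, (∀ p, p < i → x p = 0) ∧ ∀ a, ∀ S : Finset ℤ, Finset.Icc i a ⊆ S →
      ∑ b ∈ S, L a b * x b = if a = i then 1 else 0 := by
  refine ⟨fun p => if i ≤ p then zrec L i (p - i).toNat else 0, ?_, ?_⟩
  · intro p hp
    simp [hp]
  · intro a S hS
    rw [← Finset.sum_subset hS]
    · by_cases ha : i ≤ a
      · obtain ⟨m, rfl⟩ : ∃ m : ℕ, a = i + m := ⟨(a - i).toNat, by omega⟩
        have hset : Finset.Icc i (i + m) = (Finset.range (m+1)).image (fun k : ℕ => i + (k:ℤ)) := by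
          ext x
          simp only [Finset.mem_Icc, Finset.mem_image, Finset.mem_range]
          constructor
          · intro h; exact ⟨(x - i).toNat, by omega, by omega⟩
          · rintro ⟨k, hk, rfl⟩; omega
        rw [hset, Finset.sum_image (by intro x _ y _ h; simpa using h), Finset.sum_range_succ]
        simp only [le_add_iff_nonneg_right, Nat.cast_nonneg, if_true, add_sub_cancel_left,
          Int.toNat_natCast]
        have : zrec L i m = ((if m = 0 then 1 else 0) - ∑ k : Fin m, L (i + m) (i + k) * zrec L i k)
            / L (i + m) (i + m) := by
          rw [zrec]
        rw [this, mul_div_cancel₀ _ (hdiag _),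
          ← Fin.sum_univ_eq_sum_range (fun k => L (i + m) (i + k) * zrec L i k)]
        simp
      · rw [Finset.Icc_eq_empty ha, Finset.sum_empty, if_neg (by omega)]
    · intro x _ hx
      simp only [Finset.mem_Icc, not_and, not_le] at hx
      by_cases h : i ≤ x
      · rw [htri a x (hx h), zero_mul]
      · simp [h]

lemma sum_step {n : ℕ} {π : ℤ ≃ ℤ} (hπ : IsJuggling n π) (j : ℤ) :
    ∑ k ∈ Finset.Ioc (j + 1 - n) (j + 1), (π k - k) = ∑ k ∈ Finset.Ioc (j - n) j, (π k - k) := by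
  have hn := hπ.npos
  have e1 : Finset.Ioc (j + 1 - n) (j + 1) = insert (j + 1) (Finset.Ioc (j + 1 - n) j) := by
    ext x; simp only [Finset.mem_Ioc, Finset.mem_insert]; omega
  have e2 : Finset.Ioc (j - n) j = insert (j + 1 - n) (Finset.Ioc (j + 1 - n) j) := by
    ext x; simp only [Finset.mem_Ioc, Finset.mem_insert]; omega
  rw [e1, e2, Finset.sum_insert (by simp), Finset.sum_insert (by simp)]
  have := hπ.periodic (j + 1 - n)
  rw [sub_add_cancel] at this
  rw [this]; ring

lemma sum_window {n : ℕ} {π : ℤ ≃ ℤ} (hπ : IsJuggling n π) (j : ℤ) :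
    ∑ k ∈ Finset.Ioc (j - n) j, (π k - k) = ∑ k ∈ Finset.Icc (1:ℤ) n, (π k - k) := by
  have h0 : ∀ j : ℤ, ∑ k ∈ Finset.Ioc (j - n) j, (π k - k)
      = ∑ k ∈ Finset.Ioc ((0:ℤ) - n) 0, (π k - k) := by
    intro j
    induction j using Int.induction_on with
    | zero => rfl
    | succ i ih => rw [sum_step hπ, ih]
    | pred i ih => rw [← sum_step hπ, sub_add_cancel, ih]
  rw [h0 j, ← h0 n]
  congr 1
  ext x; simp only [Finset.mem_Ioc, Finset.mem_Icc]; omega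

lemma ball_count {n h : ℕ} {π : ℤ ≃ ℤ} (hπ : IsJuggling n π) (hb : HasBalls n π h) (j : ℤ) :
    ((Finset.Ioc (j - n) j).filter (fun k => j < π k)).card = h := by
  have hn := hπ.npos
  have h1 := sum_window hπ j
  rw [show ∑ k ∈ Finset.Icc (1:ℤ) n, (π k - k) = (h:ℤ) * n from hb] at h1
  set W := Finset.Ioc (j - n) j with hW
  let f : ℤ → ℤ := fun k => π k - if j < π k then (n:ℤ) else 0
  have hmem : ∀ k ∈ W, f k ∈ W := by
    intro k hk
    have a1 := hπ.le_self k
    have a2 := hπ.le_add k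
    simp only [hW, Finset.mem_Ioc, f] at *
    split_ifs <;> omega
  have hper : ∀ k, π (k - n) = π k - n := by
    intro k
    have := hπ.periodic (k - n)
    rw [sub_add_cancel] at this
    omega
  have hinj : Set.InjOn f W := by
    intro k hk l hl hkl
    simp only [hW, Finset.coe_Ioc, Set.mem_Ioc] at hk hl
    simp only [f] at hkl
    split_ifs at hkl with c1 c2 c2
    · exact π.injective (by omega)
    · have := hper k
      have : k - n = l := π.injective (by omega)
      omega
    · have := hper l
      have : l - n = k := π.injective (by omega)
      omega
    · exact π.injective (by omega)
  have himg : W.image f = W := by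
    apply Finset.eq_of_subset_of_card_le
    · intro x hx
      obtain ⟨y, hy, rfl⟩ := Finset.mem_image.1 hx
      exact hmem y hy
    · rw [Finset.card_image_of_injOn hinj]
  have hsum : ∑ k ∈ W, f k = ∑ k ∈ W, k := by
    conv_rhs => rw [← himg]
    rw [Finset.sum_image hinj]
  have h2 : ∑ k ∈ W, (if j < π k then (n:ℤ) else 0) = (h:ℤ) * n := by
    simp only [f, Finset.sum_sub_distrib] at hsum h1
    linarith
  rw [← Finset.sum_filter, Finset.sum_const, nsmul_eq_mul] at h2
  have hn' : (n:ℤ) ≠ 0 := by positivity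
  exact_mod_cast mul_right_cancel₀ hn' h2

/-- the set of crossings -/
noncomputable def Bset (n : ℕ) (π : ℤ ≃ ℤ) (i : ℤ) : Finset ℤ :=
  (Finset.Ioo i (π.symm i + n)).filter (fun i' => π.symm i' < π.symm i)

lemma le_symm_add {n : ℕ} {π : ℤ ≃ ℤ} (hπ : IsJuggling n π) (i : ℤ) : i ≤ π.symm i + n := by
  have := hπ.le_add (π.symm i); simpa using this

lemma symm_le {n : ℕ} {π : ℤ ≃ ℤ} (hπ : IsJuggling n π) (i : ℤ) : π.symm i ≤ i := by
  have := hπ.le_self (π.symm i); simpa using this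

lemma count {n h : ℕ} {π : ℤ ≃ ℤ} (hπ : IsJuggling n π) (hb : HasBalls n π h) (i : ℤ) :
    ((Set.ncard {k : ℤ | π.symm i < k ∧ π k < i} : ℕ) : ℤ)
      = i - π.symm i - h + (Bset n π i).card := by
  have hbc := ball_count hπ hb (π.symm i)
  obtain ⟨j, rfl⟩ := π.surjective i
  simp only [Bset, Equiv.symm_apply_apply] at *
  have hj := hπ.le_self j
  have hj2 := hπ.le_add j
  let A := (Finset.Ioo j (π j)).filter (fun k => π k < π j)
  let B := (Finset.Ioc (j - n) j).filter (fun k => k < j ∧ π j < π k)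
  let T := (Finset.Ioc (j - n) j).filter (fun k => k < j ∧ j < π k ∧ π k < π j)
  have hA : {k : ℤ | j < k ∧ π k < π j} = (A : Set ℤ) := by
    ext k
    have := hπ.le_self k
    simp only [A, Set.mem_ofPred_eq, Finset.coe_filter, Finset.mem_Ioo]
    constructor <;> intro h <;> omega
  rw [hA, Set.ncard_coe_finset]
  have hB : B.image π = (Finset.Ioo (π j) (j + n)).filter (fun i' => π.symm i' < j) := by
    ext x
    obtain ⟨k, rfl⟩ := π.surjective x
    have := hπ.le_self k
    have := hπ.le_add k
    simp only [B, Finset.mem_image, Finset.mem_filter, Finset.mem_Ioc, Finset.mem_Ioo,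
      Equiv.symm_apply_apply, EmbeddingLike.apply_eq_iff_eq, exists_eq_right]
    constructor <;> intro h <;> omega
  rw [← hB, Finset.card_image_of_injective _ π.injective]
  have hTA : (T ∪ A).image π = (Finset.Ioo j (π j)) := by
    ext x
    obtain ⟨k, rfl⟩ := π.surjective x
    have := hπ.le_self k
    have := hπ.le_add k
    simp only [T, A, Finset.mem_image, Finset.mem_union, Finset.mem_filter, Finset.mem_Ioc,
      Finset.mem_Ioo, EmbeddingLike.apply_eq_iff_eq, exists_eq_right]
    constructor <;> intro h
    · omega
    · have : k ≠ j := by rintro rfl; omega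
      omega
  have hTAd : Disjoint T A := by
    rw [Finset.disjoint_left]
    intro x hx hy
    simp only [T, A, Finset.mem_filter, Finset.mem_Ioo] at hx hy
    omega
  have hcard := congrArg Finset.card hTA
  rw [Finset.card_image_of_injective _ π.injective, Finset.card_union_of_disjoint hTAd,
    Int.card_Ioo] at hcard
  have hTB : Disjoint T B := by
    rw [Finset.disjoint_left]
    intro x hx hy
    simp only [T, B, Finset.mem_filter] at hx hy
    omega
  rcases hj.eq_or_lt with hjj | hjj
  · have e : (Finset.Ioc (j - n) j).filter (fun k => j < π k) = B := by
      ext x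
      simp only [B, Finset.mem_filter, Finset.mem_Ioc]
      constructor
      · intro h
        have : x ≠ j := by rintro rfl; omega
        omega
      · intro h; omega
    rw [e] at hbc
    omega
  · have e : (Finset.Ioc (j - n) j).filter (fun k => j < π k) = insert j (T ∪ B) := by
      ext x
      have hne : x ≠ j → π x ≠ π j := fun h h' => h (π.injective h')
      have hn := hπ.npos
      simp only [T, B, Finset.mem_filter, Finset.mem_Ioc, Finset.mem_insert, Finset.mem_union]
      constructor
      · intro h
        by_cases hx : x = j
        · exact Or.inl hx
        · have := hne hx
          omega
      · rintro (rfl | h)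
        · omega
        · omega
    rw [e, Finset.card_insert_of_notMem (by simp [T, B]), Finset.card_union_of_disjoint hTB] at hbc
    omega

lemma sg_eq {n : ℕ} {π : ℤ ≃ ℤ} (hπ : IsJuggling n π) (a b i : ℤ) (hab : b < a + n)
    (hai : a ≤ i) (hib : dualJug n π i ≤ b) :
    ((sg a b ((Finset.Icc a b).filter (fun i => dualJug n π i ≤ b)) (dualJug n π) i : ℕ) : ℤ)
      = i + π.symm i + n - 2 * a - (Bset n π i).card := by
  have hd : ∀ x, dualJug n π x = π.symm x + n := fun x => rfl
  have hli := le_symm_add hπ i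
  rw [hd] at hib
  unfold sg
  have e1 : (Finset.Icc a b).filter (· < i) = Finset.Ico a i := by
    ext x; simp only [Finset.mem_filter, Finset.mem_Icc, Finset.mem_Ico]; omega
  have e2 : (Finset.Icc a b \ (((Finset.Icc a b).filter (fun i => dualJug n π i ≤ b)).filter
      (fun j => i < j)).image (dualJug n π)).filter (· < dualJug n π i)
      = Finset.Ico a (π.symm i + n) \ (Bset n π i).image (dualJug n π) := by
    ext x
    obtain ⟨y, rfl⟩ := (dualJug n π).surjective x
    have := le_symm_add hπ y
    simp only [Finset.mem_filter, Finset.mem_sdiff, Finset.mem_image, Finset.mem_Icc,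
      Finset.mem_Ico, EmbeddingLike.apply_eq_iff_eq, exists_eq_right, Bset, Finset.mem_Ioo]
    simp only [hd]
    constructor <;> intro h <;> omega
  have e3 : (Bset n π i).image (dualJug n π) ⊆ Finset.Ico a (π.symm i + n) := by
    intro x hx
    obtain ⟨y, hy, rfl⟩ := Finset.mem_image.1 hx
    have := le_symm_add hπ y
    simp only [Finset.mem_filter, Finset.mem_Ico, Bset, Finset.mem_Ioo, hd] at *
    omega
  have e4 := Finset.card_le_card e3
  rw [e1, e2, Finset.card_sdiff_of_subset e3]
  rw [Finset.card_image_of_injective _ (dualJug n π).injective] at *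
  simp only [Int.card_Ico] at *
  omega

lemma pre_diag {π : ℤ ≃ ℤ} {C : ℤ → ℤ → K} (hC : IsPrefrieze π C) (p : ℤ) : C p p = 1 :=
  (hC p p).1 rfl

lemma pre_tri {π : ℤ ≃ ℤ} {C : ℤ → ℤ → K} (hC : IsPrefrieze π C) (p q : ℤ) (h : p < q) :
    C p q = 0 := (hC p q).2.2 (Or.inl (by omega))

lemma pre_low {π : ℤ ≃ ℤ} {C : ℤ → ℤ → K} (hC : IsPrefrieze π C) (p q : ℤ) (h : q < π.symm p) :
    C p q = 0 := (hC p q).2.2 (Or.inr (by omega))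

lemma pre_up {π : ℤ ≃ ℤ} {C : ℤ → ℤ → K} (hC : IsPrefrieze π C) (p q : ℤ) (h : π q < p) :
    C p q = 0 := (hC p q).2.2 (Or.inl (by omega))

lemma pre_end {π : ℤ ≃ ℤ} {C : ℤ → ℤ → K} (hC : IsPrefrieze π C) (p : ℤ) :
    C p (π.symm p) = (-1 : K) ^ Set.ncard {i : ℤ | π.symm p < i ∧ π i < p} :=
  (hC p (π.symm p)).2.1 (by simp)

lemma pre_end_sq {π : ℤ ≃ ℤ} {C : ℤ → ℤ → K} (hC : IsPrefrieze π C) (p : ℤ) :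
    C p (π.symm p) * C p (π.symm p) = 1 := by
  rw [pre_end hC, ← mul_pow]; simp

lemma pre_end_ne {π : ℤ ≃ ℤ} {C : ℤ → ℤ → K} (hC : IsPrefrieze π C) (p : ℤ) :
    C p (π.symm p) ≠ 0 := by
  intro h
  have := pre_end_sq hC p
  rw [h] at this; simp at this

lemma sign {n h : ℕ} {π : ℤ ≃ ℤ} (hπ : IsJuggling n π) (hb : HasBalls n π h) {C : ℤ → ℤ → K}
    (hC : IsPrefrieze π C) (a b i : ℤ) (hab : b < a + n)
    (hai : a ≤ i) (hib : dualJug n π i ≤ b) :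
    (-1 : K) ^ (sg a b ((Finset.Icc a b).filter (fun i => dualJug n π i ≤ b)) (dualJug n π) i)
      = -(-1 : K) ^ ((n : ℤ) - h - 1) * C i (π.symm i) := by
  have h1 := sg_eq hπ a b i hab hai hib
  have h2 := count hπ hb i
  rw [pre_end hC, ← zpow_natCast, ← zpow_natCast]
  have h3 : ((sg a b ((Finset.Icc a b).filter (fun i => dualJug n π i ≤ b)) (dualJug n π) i : ℕ) : ℤ)
    = (((n:ℤ) - h - 1) + ((Set.ncard {k : ℤ | π.symm i < k ∧ π k < i} : ℕ) : ℤ) + 1)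
      + 2 * (π.symm i - a - (Bset n π i).card + h) := by
    rw [h1, h2]; ring
  have hne : (-1 : K) ≠ 0 := by simp
  rw [h3, zpow_add₀ hne, zpow_add₀ hne, zpow_add₀ hne, zpow_mul]
  simp

lemma backcol {n : ℕ} {π : ℤ ≃ ℤ} (hπ : IsJuggling n π) {C : ℤ → ℤ → K}
    (hC : IsPrefrieze π C) (i : ℤ) : ∃ y : ℤ → K, (∀ q, i < π q → y q = 0) ∧
      (∀ q, π.symm i < q → y q = 0) ∧ y (π.symm i) = C i (π.symm i) ∧
      ∀ a, ∀ S : Finset ℤ, Finset.Icc (π.symm a) a ⊆ S →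
        ∑ b ∈ S, C a b * y b = if a = i then 1 else 0 := by
  obtain ⟨z, hz1, hz2⟩ := exists_col (fun a c => C (-a) (π.symm (-c)))
    (fun a => pre_end_ne hC (-a)) (fun a b hab => pre_up hC _ _ (by simp; omega)) (-i)
  have hy1 : ∀ q, i < π q → z (-π q) = 0 := fun q hq => hz1 _ (by omega)
  have hrow : ∀ a, ∀ S : Finset ℤ, Finset.Icc (π.symm a) a ⊆ S →
        ∑ b ∈ S, C a b * z (-π b) = if a = i then 1 else 0 := by
    intro a S hS
    have h1 := hz2 (-a) ((S ∪ (Finset.Icc a i).image π.symm).image (fun q => -π q)) (by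
      intro x hx
      simp only [Finset.mem_Icc] at hx
      refine Finset.mem_image.2 ⟨π.symm (-x), Finset.mem_union_right _
        (Finset.mem_image_of_mem _ ?_), by simp⟩
      simp only [Finset.mem_Icc]; omega)
    rw [Finset.sum_image (by
      intro x _ y _ hxy
      exact π.injective (by simpa using hxy))] at h1
    simp only [neg_neg, Equiv.symm_apply_apply, neg_inj] at h1
    rw [← h1]
    apply Finset.sum_subset Finset.subset_union_left
    intro x _ hx
    have : x ∉ Finset.Icc (π.symm a) a := fun h => hx (hS h)
    simp only [Finset.mem_Icc, not_and, not_le] at this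
    by_cases hxa : π.symm a ≤ x
    · rw [pre_tri hC _ _ (this hxa), zero_mul]
    · rw [pre_low hC _ _ (by omega), zero_mul]
  have hy2 : ∀ m : ℕ, ∀ q, (i - π q).toNat = m → π.symm i < q → z (-π q) = 0 := by
    intro m
    induction m using Nat.strong_induction_on with
    | _ m ih =>
      intro q hm hq
      by_cases hqi : i < π q
      · exact hy1 q hqi
      have hne : π q ≠ i := by
        intro h; rw [← h] at hq; simp at hq
      have h1 := hrow (π q) (Finset.Icc (π.symm (π q)) (π q)) (Finset.Subset.refl _)
      rw [if_neg hne, Finset.sum_eq_single q] at h1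
      · have := pre_end_ne hC (π q)
        rw [Equiv.symm_apply_apply] at this
        exact (mul_eq_zero.1 h1).resolve_left this
      · intro b hb hbq
        rw [Equiv.symm_apply_apply, Finset.mem_Icc] at hb
        have hne' : π b ≠ π q := fun h => hbq (π.injective h)
        by_cases h3 : π b < π q
        · rw [pre_up hC _ _ h3, zero_mul]
        · by_cases h4 : i < π b
          · rw [hy1 b h4, mul_zero]
          · rw [ih _ (by omega) b rfl (by omega), mul_zero]
      · intro h
        exfalso; apply h
        have := hπ.le_self q
        simp [this]
  refine ⟨fun q => z (-π q), hy1, fun q => hy2 _ q rfl, ?_, hrow⟩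
  have h1 := hrow i (Finset.Icc (π.symm i) i) (Finset.Subset.refl _)
  rw [if_pos rfl, Finset.sum_eq_single (π.symm i)] at h1
  · have h2 := pre_end_sq hC i
    exact mul_left_cancel₀ (pre_end_ne hC i) (h1.trans h2.symm)
  · intro b hb hne
    rw [Finset.mem_Icc] at hb
    rw [hy2 _ b rfl (by omega), mul_zero]
  · intro h
    exfalso; apply h
    have := symm_le hπ i
    simp [this]

/-- `D` is the lower-triangular inverse. -/
structure IsInv (C D : ℤ → ℤ → K) : Prop where
  zero : ∀ p i, p < i → D p i = 0
  row : ∀ i a, ∀ S : Finset ℤ, Finset.Icc i a ⊆ S →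
      ∑ b ∈ S, C a b * D b i = if a = i then 1 else 0

lemma exists_inv {π : ℤ ≃ ℤ} {C : ℤ → ℤ → K} (hC : IsPrefrieze π C) : ∃ D, IsInv C D := by
  choose x h1 h2 using exists_col C (fun a => by rw [pre_diag hC]; exact one_ne_zero) (pre_tri hC)
  exact ⟨fun p i => x i p, fun p i => h1 i p, h2⟩

lemma IsInv.win {C D : ℤ → ℤ → K} (hD : IsInv C D) (a b : ℤ) :
    ∀ p ∈ Finset.Icc a b, ∀ i ∈ Finset.Icc a b,
      ∑ c ∈ Finset.Icc a b, C p c * D c i = if p = i then 1 else 0 := by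
  intro p hp i hi
  apply hD.row
  simp only [Finset.mem_Icc] at hp hi
  exact Finset.Icc_subset_Icc hi.1 hp.2

lemma finsum_row {π : ℤ ≃ ℤ} {C : ℤ → ℤ → K} (hC : IsPrefrieze π C) (x : ℤ → K) (a : ℤ)
    (S : Finset ℤ) (hS : Finset.Icc (π.symm a) a ⊆ S) :
    ∑ᶠ b, C a b * x b = ∑ b ∈ S, C a b * x b := by
  apply finsum_eq_sum_of_support_subset
  intro b hb
  apply hS
  rw [Finset.mem_Icc]
  by_contra hcon
  apply hb
  by_cases h : b < π.symm a
  · simp [pre_low hC _ _ h]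
  · simp [pre_tri hC a b (by omega)]

lemma super {n : ℕ} {π : ℤ ≃ ℤ} (hπ : IsJuggling n π) {C : ℤ → ℤ → K} {ε : K}
    (hC : IsPrefrieze π C) {D : ℤ → ℤ → K} (hD : IsInv C D)
    (H : ∀ x : ℤ → K, SolvesRec C x → ∀ a : ℤ, x (a + n) = ε * x a) (i : ℤ) :
    ∃ y : ℤ → K, (∀ q, i < π q → y q = 0) ∧
      (∀ q, π.symm i < q → y q = 0) ∧ y (π.symm i) = C i (π.symm i) ∧
      ∀ p, p < i → i < π (p + n) → D (p + n) i = -ε * y p := by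
  obtain ⟨y, h1, h2, h3, h4⟩ := backcol hπ hC i
  refine ⟨y, h1, h2, h3, ?_⟩
  intro p hp hpi
  have := H (fun q => D q i - y q) (by
    intro a
    let S := Finset.Icc (min (π.symm a) i) a
    rw [finsum_row hC _ a S (Finset.Icc_subset_Icc (min_le_left _ _) le_rfl)]
    simp only [mul_sub, Finset.sum_sub_distrib]
    rw [h4 a S (Finset.Icc_subset_Icc (min_le_left _ _) le_rfl),
      hD.row i a S (Finset.Icc_subset_Icc (min_le_right _ _) le_rfl), sub_self]) p
  simp only [h1 _ hpi, hD.zero p i hp] at this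
  rw [sub_zero, zero_sub] at this
  rw [this]; ring

lemma tame_sets (n : ℕ) {π : ℤ ≃ ℤ} (hπ : IsJuggling n π) (a b : ℤ) (hab : a < b) :
    ∃ τ : ℤ ≃ ℤ, τ a = b ∧
      (∀ j ∈ (Finset.Ioo a b).filter (fun i => dualJug n π i < b), τ j = dualJug n π j) ∧
      Finset.Ioc a b \ (Finset.Ioo a b).filter (fun i => dualJug n π i < b)
        = Finset.Icc a b \ insert a ((Finset.Ioo a b).filter (fun i => dualJug n π i < b)) ∧
      Finset.Ico a b \ ((Finset.Ioo a b).filter (fun i => dualJug n π i < b)).image (dualJug n π)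
        = Finset.Icc a b \
          (insert a ((Finset.Ioo a b).filter (fun i => dualJug n π i < b))).image τ := by
  have h2 : ∀ j ∈ (Finset.Ioo a b).filter (fun i => dualJug n π i < b),
      ((dualJug n π).trans (Equiv.swap (dualJug n π a) b)) j = dualJug n π j := by
    intro j hj
    simp only [Finset.mem_filter, Finset.mem_Ioo] at hj
    rw [Equiv.trans_apply]
    apply Equiv.swap_apply_of_ne_of_ne
    · intro h
      have := (dualJug n π).injective h
      omega
    · omega
  refine ⟨(dualJug n π).trans (Equiv.swap (dualJug n π a) b), by simp, h2, ?_, ?_⟩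
  · ext x
    simp only [Finset.mem_sdiff, Finset.mem_Ioc, Finset.mem_Icc, Finset.mem_insert]
    constructor
    · rintro ⟨h3, h4⟩
      refine ⟨by omega, ?_⟩
      rintro (h5 | h5)
      · omega
      · exact h4 h5
    · rintro ⟨h3, h4⟩
      push Not at h4
      refine ⟨by omega, h4.2⟩
  · rw [Finset.image_insert, Finset.image_congr (g := dualJug n π) (fun j hj => h2 j hj)]
    simp only [Equiv.trans_apply, Equiv.swap_apply_left]
    ext x
    simp only [Finset.mem_sdiff, Finset.mem_Ico, Finset.mem_Icc, Finset.mem_insert]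
    constructor
    · rintro ⟨h3, h4⟩
      refine ⟨by omega, ?_⟩
      rintro (h5 | h5)
      · omega
      · exact h4 h5
    · rintro ⟨h3, h4⟩
      push Not at h4
      refine ⟨by omega, h4.2⟩

lemma tame_key {n : ℕ} {π : ℤ ≃ ℤ} (hπ : IsJuggling n π) {C : ℤ → ℤ → K}
    (hC : IsPrefrieze π C) {D : ℤ → ℤ → K} (hD : IsInv C D) (a b : ℤ) (hab : a < b) :
    ∃ τ : ℤ ≃ ℤ, τ a = b ∧
      (∀ j ∈ (Finset.Ioo a b).filter (fun i => dualJug n π i < b), τ j = dualJug n π j) ∧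
      (minor C
      (Finset.Ioc a b \ (Finset.Ioo a b).filter (fun i => dualJug n π i < b))
      (Finset.Ico a b \
        ((Finset.Ioo a b).filter (fun i => dualJug n π i < b)).image (dualJug n π)) = 0 ↔
      minor (fun i' i => D (τ i') i)
        (insert a ((Finset.Ioo a b).filter (fun i => dualJug n π i < b)))
        (insert a ((Finset.Ioo a b).filter (fun i => dualJug n π i < b))) = 0) := by
  obtain ⟨τ, h1, h2, h3, h4⟩ := tame_sets n hπ a b hab
  refine ⟨τ, h1, h2, ?_⟩
  have hd : ∀ x, dualJug n π x = π.symm x + n := fun x => rfl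
  rw [h3, h4, key C D a b τ _ ?_ ?_ (pre_diag hC) (pre_tri hC) (hD.win a b)]
  · rw [mul_eq_zero]
    constructor
    · exact Or.inr
    · rintro (h | h)
      · exfalso
        rw [Finset.prod_eq_zero_iff] at h
        obtain ⟨i, _, hi⟩ := h
        exact pow_ne_zero _ (by simp) hi
      · exact h
  · intro x hx
    simp only [Finset.mem_insert, Finset.mem_filter, Finset.mem_Ioo] at hx
    rw [Finset.mem_Icc]; omega
  · intro x hx
    rw [Finset.mem_insert] at hx
    rcases hx with rfl | hx
    · rw [h1, Finset.mem_Icc]; omega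
    · rw [h2 x hx]
      simp only [Finset.mem_filter, Finset.mem_Ioo] at hx
      have := le_symm_add hπ x
      rw [hd] at *
      rw [Finset.mem_Icc]; omega

lemma frieze_key {n h : ℕ} {π : ℤ ≃ ℤ} (hπ : IsJuggling n π) (hb : HasBalls n π h)
    {C : ℤ → ℤ → K} (hC : IsPrefrieze π C) {D : ℤ → ℤ → K} (hD : IsInv C D) (a b : ℤ)
    (hab : b < a + n) :
    (minor C
      (Finset.Icc a b \ (Finset.Icc a b).filter (fun i => dualJug n π i ≤ b))
      (Finset.Icc a b \
        ((Finset.Icc a b).filter (fun i => dualJug n π i ≤ b)).image (dualJug n π)) = 1 ↔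
      minor (fun i' i => D (dualJug n π i') i)
        ((Finset.Icc a b).filter (fun i => dualJug n π i ≤ b))
        ((Finset.Icc a b).filter (fun i => dualJug n π i ≤ b)) =
      ∏ i ∈ (Finset.Icc a b).filter (fun i => dualJug n π i ≤ b),
        (-(-1 : K) ^ ((n : ℤ) - h - 1) * C i (π.symm i))) := by
  have hd : ∀ x, dualJug n π x = π.symm x + n := fun x => rfl
  rw [key C D a b (dualJug n π) _ (Finset.filter_subset _ _) ?_ (pre_diag hC) (pre_tri hC)
    (hD.win a b)]
  · rw [Finset.prod_congr rfl (fun i hi => by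
      simp only [Finset.mem_filter, Finset.mem_Icc] at hi
      exact sign hπ hb hC a b i hab hi.1.1 hi.2)]
    have hne : (∏ i ∈ (Finset.Icc a b).filter (fun i => dualJug n π i ≤ b),
        (-(-1 : K) ^ ((n : ℤ) - h - 1) * C i (π.symm i))) ≠ 0 := by
      rw [Finset.prod_ne_zero_iff]
      intro i _
      refine mul_ne_zero (neg_ne_zero.2 (zpow_ne_zero _ (by simp))) (pre_end_ne hC i)
    constructor
    · intro h; rw [h, mul_one]
    · intro h; exact mul_left_cancel₀ hne (h.trans (mul_one _).symm)
  · intro x hx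
    simp only [Finset.mem_filter, Finset.mem_Icc] at hx
    have := le_symm_add hπ x
    rw [hd] at *
    rw [Finset.mem_Icc]; omega

lemma forward {n h : ℕ} {π : ℤ ≃ ℤ} (hπ : IsJuggling n π) (hb : HasBalls n π h)
    {C : ℤ → ℤ → K} (hC : IsPrefrieze π C)
    (H : ∀ x : ℤ → K, SolvesRec C x →
        ∀ a : ℤ, x (a + n) = (-1 : K) ^ ((n : ℤ) - h - 1) * x a) : IsFrieze n π C := by
  obtain ⟨D, hD⟩ := exists_inv hC
  have hd : ∀ x, dualJug n π x = π.symm x + n := fun x => rfl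
  choose Y y1 y2 y3 y4 using super hπ hC hD H
  have hσ : ∀ i' i, π.symm i' < i → i < i' + n →
      D (dualJug n π i') i = -(-1 : K) ^ ((n : ℤ) - h - 1) * Y i (π.symm i') := by
    intro i' i h1 h2
    rw [hd, y4 i _ h1 (by rw [hπ.periodic]; simpa using h2)]
  refine ⟨hC, ?_, ?_⟩
  · intro a b h1 h2 h3
    rw [frieze_key hπ hb hC hD a b h2, minor_upper]
    · apply Finset.prod_congr rfl
      intro i hi
      simp only [Finset.mem_filter, Finset.mem_Icc, hd] at hi
      rw [hσ i i (by omega) (by omega), y3]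
    · intro p hp q hq hqp
      simp only [Finset.mem_filter, Finset.mem_Icc, hd] at hp hq
      rw [hσ p q (by omega) (by omega), y1 _ _ (by simpa using hqp), mul_zero]
  · intro a b h1
    have hab : a < b := by
      have := le_symm_add hπ a
      have := hπ.le_add b
      rw [hd] at h1
      omega
    have hbn : b < a + n := by omega
    obtain ⟨τ, t1, t2, t3⟩ := tame_key hπ hC hD a b hab
    rw [t3, minor_laplace_col _ _ _ a a (Finset.mem_insert_self _ _) (Finset.mem_insert_self _ _)]
    · have : D (τ a) a = 0 := by
        rw [t1]
        have hper := hπ.periodic (b - n)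
        rw [sub_add_cancel] at hper
        have h2 : a < π b := by
          have := hπ.le_self b; omega
        have h3 := y4 a (b - n) (by omega) (by simpa using h2)
        rw [sub_add_cancel] at h3
        rw [h3]
        rcases h1 with h1 | h1
        · rw [y2 _ _ (by rw [hd] at h1; omega), mul_zero]
        · rw [y1 _ _ (by omega), mul_zero]
      simp only [this, mul_zero, zero_mul]
    · intro p hp hpa
      rw [Finset.mem_insert] at hp
      have hp := hp.resolve_left hpa
      rw [t2 p hp]
      simp only [Finset.mem_filter, Finset.mem_Ioo, hd] at hp
      rw [hσ p a (by omega) (by omega), y1 _ _ (by simpa using hp.1.1), mul_zero]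

lemma Gval {n h : ℕ} {π : ℤ ≃ ℤ} (hπ : IsJuggling n π) (hb : HasBalls n π h)
    {C : ℤ → ℤ → K} (hC : IsPrefrieze π C) {D : ℤ → ℤ → K} (hD : IsInv C D)
    (hF : IsFrieze n π C) (a b : ℤ) (hab : b < a + n) (J : Finset ℤ)
    (hJ : ∀ i, i ∈ J ↔ a ≤ i ∧ dualJug n π i ≤ b) :
      minor (fun i' i => D (dualJug n π i') i) J J =
      ∏ i ∈ J, (-(-1 : K) ^ ((n : ℤ) - h - 1) * C i (π.symm i)) := by
  have hd : ∀ x, dualJug n π x = π.symm x + n := fun x => rfl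
  rcases J.eq_empty_or_nonempty with rfl | hne
  · rw [minor_empty]; simp
  · obtain ⟨a', ha', hmin⟩ := Finset.exists_min_image J id hne
    obtain ⟨m, hm, hmax⟩ := Finset.exists_max_image J (dualJug n π) hne
    simp only [id] at hmin
    have hJ' : J = (Finset.Icc a' (dualJug n π m)).filter
        (fun i => dualJug n π i ≤ dualJug n π m) := by
      ext x
      rw [Finset.mem_filter, Finset.mem_Icc]
      constructor
      · intro hx
        have h1 := hmin x hx
        have h2 := hmax x hx
        refine ⟨⟨h1, ?_⟩, h2⟩
        have := le_symm_add hπ x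
        rw [hd x] at h2
        omega
      · rintro ⟨⟨h1, _⟩, h2⟩
        rw [hJ] at ha' hm ⊢
        omega
    have e1 := (hJ _).1 ha'
    have e2 := (hJ _).1 hm
    have := (frieze_key hπ hb hC hD a' (dualJug n π m) (by omega)).1
      (hF.2.1 a' (dualJug n π m) (hmax _ ha') (by omega) (by
        rw [hd, hπ.periodic]
        have := hmin _ hm
        simpa using this))
    rw [← hJ'] at this
    exact this

lemma Dval {n h : ℕ} {π : ℤ ≃ ℤ} (hπ : IsJuggling n π) (hb : HasBalls n π h)
    {C : ℤ → ℤ → K} (hC : IsPrefrieze π C) {D : ℤ → ℤ → K} (hD : IsInv C D)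
    (hF : IsFrieze n π C) (b : ℤ) : ∀ m : ℕ, ∀ a, (b - a).toNat = m → dualJug n π a ≤ b → b < a + n →
      D b a = if dualJug n π a = b then
        (-(-1 : K) ^ ((n : ℤ) - h - 1) * C a (π.symm a)) else 0 := by
  have hd : ∀ x, dualJug n π x = π.symm x + n := fun x => rfl
  intro m
  induction m using Nat.strong_induction_on with
  | _ m ih =>
    intro a hm hle hlt
    have hab : a ≤ b := by
      have := le_symm_add hπ a
      rw [hd] at hle; omega
    set J := (Finset.Ioo a b).filter (fun i => dualJug n π i < b) with hJ
    have hJm : ∀ i, i ∈ J ↔ a + 1 ≤ i ∧ dualJug n π i ≤ b - 1 := by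
      intro i
      have := le_symm_add hπ i
      rw [hJ, Finset.mem_filter, Finset.mem_Ioo, hd]
      omega
    have haJ : a ∉ J := by rw [hJm]; omega
    have hz : ∀ j ∈ J, D b j = 0 := by
      intro j hj
      rw [hJm] at hj
      have := le_symm_add hπ j
      rw [hd] at hj
      rw [ih _ (by omega) j rfl (by rw [hd]; omega) (by omega), if_neg (by rw [hd]; omega)]
    have hG := Gval hπ hb hC hD hF (a + 1) (b - 1) (by omega) J hJm
    have hne : (∏ i ∈ J, (-(-1 : K) ^ ((n : ℤ) - h - 1) * C i (π.symm i))) ≠ 0 := by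
      rw [Finset.prod_ne_zero_iff]
      intro i _
      refine mul_ne_zero (neg_ne_zero.2 (zpow_ne_zero _ (by simp))) (pre_end_ne hC i)
    have hcard : (insert a J).filter (· < a) = ∅ := by
      rw [Finset.filter_eq_empty_iff]
      intro x hx
      rw [Finset.mem_insert, hJm] at hx
      omega
    have hexp : ∀ τ : ℤ ≃ ℤ, τ a = b → (∀ j ∈ J, τ j = dualJug n π j) →
        minor (fun i' i => D (τ i') i) (insert a J) (insert a J)
          = D b a * ∏ i ∈ J, (-(-1 : K) ^ ((n : ℤ) - h - 1) * C i (π.symm i)) := by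
      intro τ t1 t2
      rw [minor_laplace_row _ _ _ a a (Finset.mem_insert_self _ _) (Finset.mem_insert_self _ _)]
      · rw [hcard, Finset.erase_insert haJ, t1, ← hG]
        rw [minor_congr (fun i' i => D (τ i') i) (fun i' i => D (dualJug n π i') i) J J
          (fun p hp q _ => by rw [t2 p hp])]
        simp
      · intro p hp hpa
        rw [t1]
        exact hz p ((Finset.mem_insert.1 hp).resolve_left hpa)
    split_ifs with heq
    · have h1 := hexp (dualJug n π) heq (fun _ _ => rfl)
      have h2 := Gval hπ hb hC hD hF a b hlt (insert a J) (by
        intro i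
        rw [Finset.mem_insert, hJm]
        constructor
        · rintro (rfl | h)
          · omega
          · omega
        · rintro ⟨h3, h4⟩
          by_cases hi : i = a
          · exact Or.inl hi
          · have : dualJug n π i ≠ dualJug n π a := fun h => hi ((dualJug n π).injective h)
            right; omega)
      rw [h1, Finset.prod_insert haJ] at h2
      exact mul_right_cancel₀ hne h2
    · have hlt' : dualJug n π a < b := lt_of_le_of_ne hle heq
      have hab' : a < b := by
        have := le_symm_add hπ a
        rw [hd] at hlt'; omega
      obtain ⟨τ, t1, t2, t3⟩ := tame_key hπ hC hD a b hab'
      have h1 := t3.1 (hF.2.2 a b (Or.inl ⟨hlt', hlt⟩))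
      rw [← hJ] at h1 t2
      rw [hexp τ t1 t2] at h1
      exact (mul_eq_zero.1 h1).resolve_right hne

lemma left_inv_win {C D : ℤ → ℤ → K} (hD : IsInv C D) (a b : ℤ) (p q : ℤ)
    (hp : p ∈ Finset.Icc a b) (hq : q ∈ Finset.Icc a b) :
    ∑ c ∈ Finset.Icc a b, D p c * C c q = if p = q then 1 else 0 := by
  let Cm : Matrix (Finset.Icc a b) (Finset.Icc a b) K := Matrix.of fun i j => C i j
  let Dm : Matrix (Finset.Icc a b) (Finset.Icc a b) K := Matrix.of fun i j => D i j
  have h1 : Cm * Dm = 1 := by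
    ext i j
    rw [Matrix.mul_apply, Matrix.one_apply]
    have := hD.win a b i i.2 j j.2
    rw [← Finset.sum_coe_sort] at this
    simp only [Subtype.ext_iff]
    exact this
  have h2 : Dm * Cm = 1 := mul_eq_one_comm.1 h1
  have h3 := congrFun (congrFun h2 ⟨p, hp⟩) ⟨q, hq⟩
  rw [Matrix.mul_apply, Matrix.one_apply] at h3
  rw [← Finset.sum_coe_sort]
  simp only [Subtype.mk.injEq] at h3
  exact h3

lemma backward {n h : ℕ} {π : ℤ ≃ ℤ} (hπ : IsJuggling n π) (hb : HasBalls n π h)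
    {C : ℤ → ℤ → K} (hC : IsPrefrieze π C) (hF : IsFrieze n π C) (x : ℤ → K)
    (hx : SolvesRec C x) (k : ℤ) :
    x (k + n) = (-1 : K) ^ ((n : ℤ) - h - 1) * x k := by
  obtain ⟨D, hD⟩ := exists_inv hC
  have hd : ∀ x, dualJug n π x = π.symm x + n := fun x => rfl
  have hn := hπ.npos
  set W := Finset.Icc (k + 1) (k + n) with hW
  let r : ℤ → K := fun a => ∑ c ∈ W, C a c * x c
  have hbW : k + n ∈ W := by rw [hW, Finset.mem_Icc]; omega
  have h1 : x (k + n) = ∑ a ∈ W, D (k + n) a * r a := by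
    simp only [r, Finset.mul_sum]
    rw [Finset.sum_comm]
    have : ∀ c ∈ W, ∑ a ∈ W, D (k + n) a * (C a c * x c) = (if k + n = c then 1 else 0) * x c := by
      intro c hc
      rw [← left_inv_win hD (k+1) (k+n) (k+n) c hbW hc, Finset.sum_mul]
      exact Finset.sum_congr rfl (fun _ _ => by ring)
    rw [Finset.sum_congr rfl this]
    simp [hbW]
  have h2 : ∀ a ∈ W, r a = -∑ c ∈ Finset.Icc (π.symm a) k, C a c * x c := by
    intro a ha
    have h3 := hx a
    rw [hW, Finset.mem_Icc] at ha
    rw [finsum_row hC x a (Finset.Icc (π.symm a) k ∪ W), Finset.sum_union] at h3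
    · exact eq_neg_of_add_eq_zero_right h3
    · rw [Finset.disjoint_left]
      intro y hy hy'
      simp only [hW, Finset.mem_Icc] at hy hy'
      omega
    · intro y hy
      simp only [hW, Finset.mem_Icc, Finset.mem_union] at hy ⊢
      omega
  have h3 : ∀ a ∈ W, k < π.symm a → r a = 0 := by
    intro a ha hk
    rw [h2 a ha, Finset.Icc_eq_empty (by omega)]; simp
  have h4 : ∀ a ∈ W, a ≠ π k → D (k + n) a * r a = 0 := by
    intro a ha hne
    by_cases hk : k < π.symm a
    · rw [h3 a ha hk, mul_zero]
    · have ha' := Finset.mem_Icc.1 ha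
      rw [Dval hπ hb hC hD hF (k + n) _ a rfl (by rw [hd]; omega) (by omega), if_neg, zero_mul]
      rw [hd]
      intro h
      apply hne
      have : π.symm a = k := by omega
      rw [← this]; simp
  rcases (hπ.le_self k).eq_or_lt with hk | hk
  · have hxk : x k = 0 := by
      have h5 := hx k
      have hs : π.symm k = k := by rw [Equiv.symm_apply_eq]; exact hk
      rw [finsum_row hC x k {k} (by rw [hs]; simp)] at h5
      simpa [pre_diag hC] using h5
    rw [h1, hxk, mul_zero]
    apply Finset.sum_eq_zero
    intro a ha
    apply h4 a ha
    rw [hW, Finset.mem_Icc] at ha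
    omega
  · have hkW : π k ∈ W := by
      have := hπ.le_add k
      rw [hW, Finset.mem_Icc]; omega
    rw [h1, Finset.sum_eq_single (π k) h4 (fun h => absurd hkW h), h2 _ hkW,
      Dval hπ hb hC hD hF (k + n) _ (π k) rfl (by rw [hd]; simp) (by omega),
      if_pos (by rw [hd]; simp)]
    simp only [Equiv.symm_apply_apply, Finset.Icc_self, Finset.sum_singleton]
    have := pre_end_sq hC (π k)
    rw [Equiv.symm_apply_apply] at this
    linear_combination ((-1 : K) ^ ((n : ℤ) - h - 1) * x k) * this

end JF

/-- **Juggler's friezes as linear recurrences.** A `π`-prefrieze `C` (with `π` of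
period `n` and `h` balls) is a `π`-frieze iff every solution `x` of `C x = 0`
satisfies `x (a+n) = (-1)^(n-h-1) * x a` for all `a`. -/
theorem frieze_iff_superperiodic (n h : ℕ) (π : ℤ ≃ ℤ) (hπ : IsJuggling n π)
    (hballs : HasBalls n π h) (C : ℤ → ℤ → K) (hC : IsPrefrieze π C) :
    IsFrieze n π C ↔
      ∀ x : ℤ → K, SolvesRec C x →
        ∀ a : ℤ, x (a + n) = (-1 : K) ^ ((n : ℤ) - h - 1) * x a := by
  exact ⟨fun hF x hx a => JF.backward hπ hballs hC hF x hx a, fun H => JF.forward hπ hballs hC H⟩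
end

section
/- Let 0 < k < n, over a field 𝕜, and for a consecutively unimodular k×n matrix A let F(A) be the ℤ×ℤ matrix with F(A)_{a,b} := det(A_{[a+1,a+k−1]∪{b}}) if b ≤ a ≤ b + n − k and 0 otherwise. Then: (i) for every SL(k)-frieze C of height n − k there exists a consecutively unimodular k×n matrix A with F(A) = C; and (ii) for consecutively unimodular k×n matrices A, A′, F(A) = F(A′) if and only if A′ = G·A for some G ∈ SL(k,𝕜). Hence F induces a bijection from SL(k,𝕜)-orbits (under left multiplication) of consecutively unimodular k×n matrices onto the set of SL(k)-friezes of height n − k. -/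
open Finset

variable {K : Type*} [Field K]

/-- A prefrieze of height `h`: `C a a = 1` and `C (a+h) a = 1` for all `a`, and
`C a b = 0` whenever `a < b` or `a > b + h`. -/
def IsPrefriezeH (h : ℕ) (C : ℤ → ℤ → K) : Prop :=
  (∀ a : ℤ, C a a = 1) ∧ (∀ a : ℤ, C (a + h) a = 1) ∧
  (∀ a b : ℤ, a < b ∨ b + h < a → C a b = 0)

/-- An `SL(k)`-frieze of height `h`. -/
def IsSLFrieze (k h : ℕ) (C : ℤ → ℤ → K) : Prop :=
  IsPrefriezeH h C ∧
  (∀ a b : ℤ, b ≤ a → a ≤ b + h →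
    minor C (Finset.Icc a (a + k - 1)) (Finset.Icc b (b + k - 1)) = 1) ∧
  (∀ a b : ℤ, b < a → a < b + h →
    minor C (Finset.Icc a (a + k)) (Finset.Icc b (b + k)) = 0)

/-- The residue of `a` mod `n`, as an element of `Fin n` (with `{1, …, n}`
identified order-preservingly with `Fin n` via `r ↦ r - 1`). -/
def resFin (n : ℕ) [NeZero n] (a : ℤ) : Fin n :=
  ⟨((a - 1) % (n : ℤ)).toNat % n, Nat.mod_lt _ (Nat.pos_of_ne_zero (NeZero.ne n))⟩

/-- The determinant of the submatrix of the `k × n` matrix `A` on the columns indexed by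
the residues mod `n` of elements of `I`, taken in increasing order of residue
(junk value `0` if the number of distinct residues is not `k`). -/
noncomputable def cdet {k n : ℕ} [NeZero n] (A : Matrix (Fin k) (Fin n) K)
    (I : Finset ℤ) : K :=
  if h : (I.image (resFin n)).card = k then
    Matrix.det (Matrix.of fun i j : Fin k => A i ((I.image (resFin n)).orderEmbOfFin h j))
  else 0

/-- The dot product of the `a`-th column of `T` with the `b`-th column of `A`
(columns indexed by `ℤ` mod `n`). -/
def dotc {k n : ℕ} [NeZero n] (T A : Matrix (Fin k) (Fin n) K) (a b : ℤ) : K :=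
  ∑ i : Fin k, T i (resFin n a) * A i (resFin n b)

/-- A `k × n` matrix is consecutively unimodular if every minor on `k` cyclically
consecutive columns is `1`. -/
def ConsecUnimodular (n : ℕ) [NeZero n] {k : ℕ} (A : Matrix (Fin k) (Fin n) K) : Prop :=
  ∀ a : ℤ, cdet A (Finset.Icc a (a + k - 1)) = 1

/-- `T` is the (right) twist `τ(A)` of the consecutively unimodular matrix `A`:
`A_a ⬝ τ(A)_b = 1` if `a = b`, and `= 0` if `b < a < b + k`. -/
def IsTwistCU (n : ℕ) [NeZero n] {k : ℕ} (A T : Matrix (Fin k) (Fin n) K) : Prop :=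
  ∀ a b : ℤ, (a = b → dotc A T a b = 1) ∧ (b < a → a < b + k → dotc A T a b = 0)

/-- The frieze `F(A)` of a consecutively unimodular `k × n` matrix `A`. -/
noncomputable def FCU (n : ℕ) [NeZero n] {k : ℕ} (A : Matrix (Fin k) (Fin n) K) :
    ℤ → ℤ → K :=
  fun a b =>
    if b ≤ a ∧ a ≤ b + (n : ℤ) - k then cdet A (Finset.Icc (a + 1) (a + k - 1) ∪ {b})
    else 0


/-! ## Helper lemmas -/

lemma minor_Icc (C : ℤ → ℤ → K) (a b a' b' : ℤ) (k : ℕ) (ha : a' = a + k - 1)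
    (hb : b' = b + k - 1) :
    minor C (Finset.Icc a a') (Finset.Icc b b') =
      Matrix.det (Matrix.of fun i j : Fin k => C (a + (i : ℕ)) (b + (j : ℕ))) := by
  subst ha hb
  have hI : (Finset.Icc a (a + k - 1)).card = k := by simp
  have hJ : (Finset.Icc b (b + k - 1)).card = k := by simp
  unfold minor
  rw [dif_pos (hJ.trans hI.symm)]
  have key : ∀ (m : ℕ) (h1 : (Finset.Icc a (a + k - 1)).card = m)
      (h2 : (Finset.Icc b (b + k - 1)).card = m), m = k →
      Matrix.det (Matrix.of fun i j : Fin m =>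
      C ((Finset.Icc a (a + k - 1)).orderEmbOfFin h1 i)
        ((Finset.Icc b (b + k - 1)).orderEmbOfFin h2 j)) =
      Matrix.det (Matrix.of fun i j : Fin k => C (a + (i : ℕ)) (b + (j : ℕ))) := by
    intro m h1 h2 hm
    subst hm
    have e1 : (fun i : Fin m => a + ((i : ℕ) : ℤ)) =
        (Finset.Icc a (a + m - 1)).orderEmbOfFin h1 := by
      apply Finset.orderEmbOfFin_unique
      · intro x
        simp only [Finset.mem_Icc]
        omega
      · intro x y h
        simpa using h
    have e2 : (fun i : Fin m => b + ((i : ℕ) : ℤ)) =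
        (Finset.Icc b (b + m - 1)).orderEmbOfFin h2 := by
      apply Finset.orderEmbOfFin_unique
      · intro x
        simp only [Finset.mem_Icc]
        omega
      · intro x y h
        simpa using h
    rw [← e1, ← e2]
  exact key _ rfl _ hI

lemma resFin_val (n : ℕ) [NeZero n] (a : ℤ) : ((resFin n a : ℕ) : ℤ) = (a - 1) % n := by
  have hn : (0 : ℤ) < n := by exact_mod_cast Nat.pos_of_ne_zero (NeZero.ne n)
  have h1 := Int.emod_nonneg (a - 1) hn.ne'
  have h2 := Int.emod_lt_of_pos (a - 1) hn
  unfold resFin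
  simp only
  rw [Nat.mod_eq_of_lt (by omega)]
  omega

lemma resFin_add (n : ℕ) [NeZero n] (a : ℤ) : resFin n (a + n) = resFin n a := by
  apply Fin.ext
  have h1 := resFin_val n a
  have h2 := resFin_val n (a + n)
  have : (a + n - 1) % (n : ℤ) = (a - 1) % n := by
    rw [show a + n - 1 = a - 1 + n by ring, Int.add_emod_right]
  omega

/-- Quasi-periodic extension of the columns of `A`. -/
noncomputable def cext {m n : ℕ} [NeZero n] (A : Matrix (Fin (m + 1)) (Fin n) K) (a : ℤ)
    (i : Fin (m + 1)) : K :=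
  ((-1 : K) ^ m) ^ ((a - 1) / (n : ℤ)) * A i (resFin n a)

lemma sg_ne (m : ℕ) : ((-1 : K) ^ m) ≠ 0 := by simp

lemma cext_add {m n : ℕ} [NeZero n] (A : Matrix (Fin (m + 1)) (Fin n) K) (a : ℤ)
    (i : Fin (m + 1)) : cext A (a + n) i = (-1) ^ m * cext A a i := by
  have hn : (n : ℤ) ≠ 0 := by exact_mod_cast NeZero.ne n
  unfold cext
  rw [resFin_add, show a + n - 1 = a - 1 + n by ring, Int.add_ediv_of_dvd_right (dvd_refl _),
    Int.ediv_self hn, zpow_add₀ (sg_ne m)]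
  simp only [zpow_one]
  ring

/-- determinant of the extended columns -/
noncomputable def W {m n : ℕ} [NeZero n] (A : Matrix (Fin (m + 1)) (Fin n) K)
    (s : Fin (m + 1) → ℤ) : K :=
  Matrix.det (Matrix.of fun i j => cext A (s j) i)

lemma sg_pow (m : ℕ) (q : ℤ) : ((((-1 : K) ^ m) ^ q) ^ (m + 1)) = 1 := by
  rw [← zpow_natCast, zpow_comm, zpow_natCast, ← pow_mul, Even.neg_one_pow, one_zpow]
  exact Nat.even_mul_succ_self m

lemma cdet_base {m n : ℕ} [NeZero n] (A : Matrix (Fin (m + 1)) (Fin n) K)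
    (s : Fin (m + 1) → ℤ) (hs : StrictMono s) (q : ℤ)
    (h1 : ∀ j, q * n < s j) (h2 : ∀ j, s j ≤ q * n + n) :
    cdet A (Finset.univ.image s) = W A s := by
  have hn : (0 : ℤ) < n := by exact_mod_cast Nat.pos_of_ne_zero (NeZero.ne n)
  have hq : ∀ j, (s j - 1) / (n : ℤ) = q := by
    intro j
    have := h1 j
    have := h2 j
    rw [Int.ediv_eq_iff_of_pos hn]
    constructor <;> linarith
  have hr : ∀ j, ((resFin n (s j) : ℕ) : ℤ) = s j - 1 - q * n := by
    intro j
    rw [resFin_val, Int.emod_def, hq]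
    ring
  have hm : StrictMono (fun j => resFin n (s j)) := by
    intro x y h
    have := hs h
    show ((resFin n (s x) : Fin n) : ℕ) < (resFin n (s y) : Fin n)
    have := hr x
    have := hr y
    omega
  have himg : (Finset.univ.image s).image (resFin n) =
      Finset.univ.image (fun j => resFin n (s j)) := by
    rw [Finset.image_image]; rfl
  have hc : ((Finset.univ.image s).image (resFin n)).card = m + 1 := by
    rw [himg, Finset.card_image_of_injective _ hm.injective]; simp
  unfold cdet
  rw [dif_pos hc]
  have e : (fun j => resFin n (s j)) =
      ((Finset.univ.image s).image (resFin n)).orderEmbOfFin hc := by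
    apply Finset.orderEmbOfFin_unique
    · intro x
      rw [himg]
      exact Finset.mem_image_of_mem _ (Finset.mem_univ x)
    · exact hm
  rw [← e]
  unfold W cext
  simp only [hq]
  have := Matrix.det_mul_row (fun _ => ((-1 : K) ^ m) ^ q)
    (Matrix.of fun (i j : Fin (m + 1)) => A i (resFin n (s j)))
  simp only [Matrix.of_apply, Finset.prod_const, Finset.card_univ, Fintype.card_fin, sg_pow,
    one_mul] at this
  exact this.symm

lemma W_rot {m n : ℕ} [NeZero n] (A : Matrix (Fin (m + 1)) (Fin n) K) (b : ℤ)
    (s : Fin m → ℤ) :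
    W A (Fin.snoc (α := fun _ => ℤ) s (b + n)) = W A (Fin.cons (α := fun _ => ℤ) b s) := by
  unfold W
  have : (Matrix.of fun i j => cext A (Fin.snoc (α := fun _ => ℤ) s (b + n) j) i) =
    Matrix.of fun i j => (if j = Fin.last m then (-1 : K) ^ m else 1) *
      ((Matrix.of fun i j => cext A (Fin.cons (α := fun _ => ℤ) b s j) i).submatrix id
        (finRotate (m + 1))) i j := by
    ext i j
    refine Fin.lastCases ?_ (fun j => ?_) j
    · simp [cext_add]
    · simp [(Fin.castSucc_lt_last j).ne]
  rw [this, Matrix.det_mul_row, Matrix.det_permute', sign_finRotate]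
  simp only [Finset.prod_ite_eq', Finset.mem_univ, if_true]
  rw [← mul_assoc]
  have : ((-1 : K) ^ m) * (-1) ^ m = 1 := by
    rw [← mul_pow]; simp
  simp [this]

lemma cdet_congr {k n : ℕ} [NeZero n] (A : Matrix (Fin k) (Fin n) K) (I J : Finset ℤ)
    (h : I.image (resFin n) = J.image (resFin n)) : cdet A I = cdet A J := by
  unfold cdet
  simp only [h]

lemma cdet_eq {m n : ℕ} [NeZero n] (A : Matrix (Fin (m + 1)) (Fin n) K)
    (s : Fin (m + 1) → ℤ) (hs : StrictMono s) (hw : ∀ i j, s j < s i + n) :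
    cdet A (Finset.univ.image s) = W A s := by
  have hn : (0 : ℤ) < n := by exact_mod_cast Nat.pos_of_ne_zero (NeZero.ne n)
  obtain ⟨q, hq⟩ : ∃ q : ℤ, s (Fin.last m) ≤ q * n + n ∧ q * n < s (Fin.last m) := by
    refine ⟨(s (Fin.last m) - 1) / n, ?_, ?_⟩
    · have := Int.lt_ediv_add_one_mul_self (s (Fin.last m) - 1) hn
      linarith
    · have := Int.ediv_mul_le (s (Fin.last m) - 1) hn.ne'
      linarith
  obtain ⟨hq, -⟩ := hq
  have hall : ∀ j, s j ≤ q * n + n := fun j => (hs.monotone (Fin.le_last j)).trans hq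
  clear hq
  obtain ⟨N, hN⟩ : ∃ N : ℕ, ∑ j, (q * n + n - s j) < N :=
    ⟨(∑ j, (q * n + n - s j)).toNat + 1, by push_cast; omega⟩
  induction N generalizing s with
  | zero =>
    exfalso
    have : 0 ≤ ∑ j, (q * n + n - s j) := Finset.sum_nonneg fun j _ => by linarith [hall j]
    push_cast at hN
    linarith
  | succ N ih =>
    by_cases h0 : q * n < s 0
    · exact cdet_base A s hs q (fun j => h0.trans_le (hs.monotone (Fin.zero_le j))) hall
    · obtain ⟨b, t, rfl⟩ : ∃ b t, s = Fin.cons (α := fun _ => ℤ) b t :=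
        ⟨s 0, Fin.tail s, (Fin.cons_self_tail s).symm⟩
      simp only [Fin.cons_zero] at h0
      rw [← W_rot, ← ih (Fin.snoc (α := fun _ => ℤ) t (b + n))]
      · apply cdet_congr
        ext x
        simp only [Finset.mem_image, Finset.mem_univ, true_and, exists_exists_eq_and]
        constructor
        · rintro ⟨j, rfl⟩
          refine Fin.cases ?_ (fun j => ?_) j
          · exact ⟨Fin.last m, by simp [resFin_add]⟩
          · exact ⟨j.castSucc, by simp⟩
        · rintro ⟨j, rfl⟩
          refine Fin.lastCases ?_ (fun j => ?_) j
          · exact ⟨0, by simp [resFin_add]⟩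
          · exact ⟨j.succ, by simp⟩
      · intro x y
        refine Fin.lastCases ?_ (fun y => ?_) y
        · refine Fin.lastCases ?_ (fun x => ?_) x
          · simp
          · intro _
            simpa using hw 0 x.succ
        · refine Fin.lastCases ?_ (fun x => ?_) x
          · intro h
            exact absurd h (not_lt.2 (Fin.le_last _))
          · intro h
            simpa using hs (show x.succ < y.succ by simpa using h)
      · intro x y
        refine Fin.lastCases ?_ (fun y => ?_) y
        · refine Fin.lastCases ?_ (fun x => ?_) x
          · simpa using hn
          · have := hs (show 0 < x.succ from Fin.succ_pos x)
            simp at this ⊢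
            linarith
        · refine Fin.lastCases ?_ (fun x => ?_) x
          · have := hw 0 y.succ
            simp at this ⊢
            linarith
          · simpa using hw x.succ y.succ
      · intro j
        refine Fin.lastCases ?_ (fun j => ?_) j
        · simp; linarith
        · simpa using hall j.succ
      · rw [Fin.sum_univ_succ] at hN
        rw [Fin.sum_univ_castSucc]
        simp only [Fin.cons_zero, Fin.cons_succ, Fin.snoc_castSucc, Fin.snoc_last] at hN ⊢
        push_cast at hN
        linarith

lemma cdet_Icc {m n : ℕ} [NeZero n] (hmn : m + 1 < n) (A : Matrix (Fin (m + 1)) (Fin n) K)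
    (a : ℤ) : cdet A (Finset.Icc a (a + ((m + 1 : ℕ) : ℤ) - 1)) =
      W A (fun j => a + ((j : ℕ) : ℤ)) := by
  rw [← cdet_eq]
  · congr 1
    ext x
    simp only [Finset.mem_Icc, Finset.mem_image, Finset.mem_univ, true_and]
    constructor
    · intro h
      exact ⟨⟨(x - a).toNat, by omega⟩, by simp; omega⟩
    · rintro ⟨j, rfl⟩
      omega
  · intro x y h
    simpa using h
  · intro x y
    omega

/-- the linear functional -/
noncomputable def L {m n : ℕ} [NeZero n] (A : Matrix (Fin (m + 1)) (Fin n) K) (a b : ℤ) : K :=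
  W A (Fin.cons (α := fun _ => ℤ) b (fun j : Fin m => a + 1 + ((j : ℕ) : ℤ)))

lemma cdet_L {m n : ℕ} [NeZero n] (hmn : m + 1 < n) (A : Matrix (Fin (m + 1)) (Fin n) K)
    (a b : ℤ) (h1 : b ≤ a) (h2 : a ≤ b + n - ((m + 1 : ℕ) : ℤ)) :
    cdet A (Finset.Icc (a + 1) (a + ((m + 1 : ℕ) : ℤ) - 1) ∪ {b}) = L A a b := by
  unfold L
  rw [← cdet_eq]
  · congr 1
    ext x
    simp only [Finset.mem_Icc, Finset.mem_image, Finset.mem_univ, true_and, Finset.mem_union,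
      Finset.mem_singleton]
    constructor
    · rintro (h | rfl)
      · exact ⟨Fin.succ ⟨(x - a - 1).toNat, by omega⟩, by rw [Fin.cons_succ]; simp only; omega⟩
      · exact ⟨0, by simp⟩
    · rintro ⟨j, rfl⟩
      refine Fin.cases ?_ (fun j => ?_) j
      · simp
      · left
        simp
        omega
  · intro x y
    refine Fin.cases ?_ (fun y => ?_) y
    · intro h
      exact absurd h (not_lt.2 (Fin.zero_le _))
    · refine Fin.cases ?_ (fun x => ?_) x
      · simp; omega
      · simp
  · intro x y
    refine Fin.cases ?_ (fun y => ?_) y <;> refine Fin.cases ?_ (fun x => ?_) x <;> simp <;> omega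

/-- coefficients of the functional -/
noncomputable def lam {m n : ℕ} [NeZero n] (A : Matrix (Fin (m + 1)) (Fin n) K) (a : ℤ)
    (i : Fin (m + 1)) : K :=
  (-1) ^ (i : ℕ) * Matrix.det (Matrix.of fun (i' : Fin m) (j : Fin m) =>
    cext A (a + 1 + ((j : ℕ) : ℤ)) (i.succAbove i'))

lemma L_eq {m n : ℕ} [NeZero n] (A : Matrix (Fin (m + 1)) (Fin n) K) (a b : ℤ) :
    L A a b = ∑ i, lam A a i * cext A b i := by
  unfold L W lam
  rw [Matrix.det_succ_column_zero]
  refine Finset.sum_congr rfl fun i _ => ?_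
  have : (Matrix.of fun (i : Fin (m + 1)) j => cext A (Fin.cons (α := fun _ => ℤ) b
      (fun j : Fin m => a + 1 + ((j : ℕ) : ℤ)) j) i).submatrix i.succAbove Fin.succ =
      Matrix.of fun (i' : Fin m) (j : Fin m) =>
    cext A (a + 1 + ((j : ℕ) : ℤ)) (i.succAbove i') := by
    ext x y
    simp
  rw [this]
  simp
  ring

lemma L_zero {m n : ℕ} [NeZero n] (A : Matrix (Fin (m + 1)) (Fin n) K) (a b : ℤ)
    (h1 : a < b) (h2 : b ≤ a + m) : L A a b = 0 := by
  unfold L W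
  refine Matrix.det_zero_of_column_eq (i := 0) (j := Fin.succ ⟨(b - a - 1).toNat, by omega⟩)
    (Fin.succ_ne_zero _).symm ?_
  intro k
  rw [Matrix.of_apply, Matrix.of_apply, Fin.cons_succ, Fin.cons_zero]
  congr 1
  simp only
  omega

lemma L_add {m n : ℕ} [NeZero n] (A : Matrix (Fin (m + 1)) (Fin n) K) (a b : ℤ) :
    L A a (b + n) = (-1) ^ m * L A a b := by
  rw [L_eq, L_eq, Finset.mul_sum]
  refine Finset.sum_congr rfl fun i _ => ?_
  rw [cext_add]; ring

lemma L_zero' {m n : ℕ} [NeZero n] (A : Matrix (Fin (m + 1)) (Fin n) K) (a b : ℤ)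
    (h1 : a < b + n) (h2 : b + n ≤ a + m) : L A a b = 0 := by
  have := L_zero A a (b + n) h1 h2
  rw [L_add] at this
  exact (mul_eq_zero.1 this).resolve_left (sg_ne m)

lemma FCU_eq {m n : ℕ} [NeZero n] (hmn : m + 1 < n) (A : Matrix (Fin (m + 1)) (Fin n) K)
    (a b : ℤ) (h1 : b ≤ a + m) (h2 : a < b + n) : FCU n A a b = L A a b := by
  unfold FCU
  split_ifs with h
  · exact cdet_L hmn A a b h.1 h.2
  · rw [not_and_or] at h
    rcases h with h | h
    · rw [L_zero A a b (by omega) h1]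
    · rw [L_zero' A a b h2 (by push_cast at h; omega)]

lemma L_self {m n : ℕ} [NeZero n] (hmn : m + 1 < n) (A : Matrix (Fin (m + 1)) (Fin n) K)
    (hA : ConsecUnimodular n A) (a : ℤ) : L A a a = 1 := by
  have h := hA a
  rw [cdet_Icc hmn] at h
  rw [← h]
  unfold L
  congr 1
  ext j
  refine Fin.cases ?_ (fun j => ?_) j
  · simp
  · simp; ring

lemma FCU_self {m n : ℕ} [NeZero n] (hmn : m + 1 < n) (A : Matrix (Fin (m + 1)) (Fin n) K)
    (hA : ConsecUnimodular n A) (a : ℤ) : FCU n A a a = 1 := by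
  rw [FCU_eq hmn A a a (by omega) (by omega), L_self hmn A hA]

lemma FCU_bot {m n : ℕ} [NeZero n] (hmn : m + 1 < n) (A : Matrix (Fin (m + 1)) (Fin n) K)
    (hA : ConsecUnimodular n A) (a b : ℤ) (h : a + ((m + 1 : ℕ) : ℤ) = b + n) :
    FCU n A a b = 1 := by
  unfold FCU
  rw [if_pos (by omega), ← hA (a + 1)]
  apply cdet_congr
  rw [Finset.image_union, Finset.image_singleton, ← resFin_add n b, ← h,
    ← Finset.image_singleton, ← Finset.image_union]
  congr 1
  ext x
  simp only [Finset.mem_Icc, Finset.mem_union, Finset.mem_singleton]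
  omega

/-- matrix of coefficients for consecutive rows -/
noncomputable def Lam {m n : ℕ} [NeZero n] (A : Matrix (Fin (m + 1)) (Fin n) K) (a : ℤ)
    (r : ℕ) : Matrix (Fin r) (Fin (m + 1)) K :=
  Matrix.of fun i l => lam A (a + ((i : ℕ) : ℤ)) l

/-- matrix of consecutive columns -/
noncomputable def Ecol {m n : ℕ} [NeZero n] (A : Matrix (Fin (m + 1)) (Fin n) K) (b : ℤ)
    (r : ℕ) : Matrix (Fin (m + 1)) (Fin r) K :=
  Matrix.of fun l j => cext A (b + ((j : ℕ) : ℤ)) l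

lemma Lam_mul {m n : ℕ} [NeZero n] (A : Matrix (Fin (m + 1)) (Fin n) K) (a b : ℤ) (r s : ℕ)
    (i : Fin r) (j : Fin s) :
    (Lam A a r * Ecol A b s) i j = L A (a + ((i : ℕ) : ℤ)) (b + ((j : ℕ) : ℤ)) := by
  rw [L_eq, Matrix.mul_apply]
  rfl

lemma det_Ecol {m n : ℕ} [NeZero n] (hmn : m + 1 < n) (A : Matrix (Fin (m + 1)) (Fin n) K)
    (hA : ConsecUnimodular n A) (a : ℤ) : (Ecol A a (m + 1)).det = 1 := by
  have h := hA a
  rwa [cdet_Icc hmn] at h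

lemma det_Lam {m n : ℕ} [NeZero n] (hmn : m + 1 < n) (A : Matrix (Fin (m + 1)) (Fin n) K)
    (hA : ConsecUnimodular n A) (a : ℤ) : (Lam A a (m + 1)).det = 1 := by
  have h : (Lam A a (m + 1) * Ecol A a (m + 1)).det = 1 := by
    rw [Matrix.det_of_isLowerTriangular]
    · apply Finset.prod_eq_one
      intro i _
      rw [Lam_mul, L_self hmn A hA]
    · intro i j hij
      have hij : i < j := by simpa using hij
      rw [Lam_mul, L_zero] <;> omega
  rwa [Matrix.det_mul, det_Ecol hmn A hA, mul_one] at h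

lemma FCU_frieze {m n h : ℕ} [NeZero n] (hmn : m + 1 < n) (hh : n = m + 1 + h)
    (A : Matrix (Fin (m + 1)) (Fin n) K)
    (hA : ConsecUnimodular n A) : IsSLFrieze (m + 1) h (FCU n A) := by
  refine ⟨⟨FCU_self hmn A hA, ?_, ?_⟩, ?_, ?_⟩
  · intro a
    apply FCU_bot hmn A hA
    rw [hh]; push_cast; ring
  · intro a b hab
    unfold FCU
    rw [if_neg]
    rw [hh]; push_cast
    omega
  · intro a b h1 h2
    rw [minor_Icc (FCU n A) a b _ _ (m + 1) rfl rfl]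
    rw [show (Matrix.of fun i j : Fin (m + 1) => FCU n A (a + (i : ℕ)) (b + (j : ℕ))) =
      Lam A a (m + 1) * Ecol A b (m + 1) from ?_, Matrix.det_mul, det_Lam hmn A hA,
      det_Ecol hmn A hA, one_mul]
    ext i j
    rw [Lam_mul, Matrix.of_apply, FCU_eq hmn] <;> omega
  · intro a b h1 h2
    rw [minor_Icc (FCU n A) a b _ _ (m + 1 + 1) (by push_cast; ring) (by push_cast; ring)]
    rw [show (Matrix.of fun i j : Fin (m + 1 + 1) => FCU n A (a + (i : ℕ)) (b + (j : ℕ))) =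
      Lam A a (m + 1 + 1) * Ecol A b (m + 1 + 1) from ?_]
    · by_contra hne
      have := Matrix.rank_of_det_ne_zero hne
      have h3 := (Matrix.rank_mul_le_left (Lam A a (m + 1 + 1)) (Ecol A b (m + 1 + 1))).trans
        (Matrix.rank_le_width _)
      simp at this
      omega
    ext i j
    rw [Lam_mul, Matrix.of_apply, FCU_eq hmn] <;> omega

lemma corner {m : ℕ} (M N : Matrix (Fin (m + 1)) (Fin (m + 1)) K) (p : Fin (m + 1))
    (hMN : ∀ i j, (i ≠ p ∨ j ≠ p) → M i j = N i j) (hd : M.det = N.det)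
    (hc : (N.submatrix p.succAbove p.succAbove).det = 1) : M p p = N p p := by
  rw [Matrix.det_succ_column M p, Matrix.det_succ_column N p] at hd
  have hs : ∀ i : Fin (m + 1), M.submatrix i.succAbove p.succAbove =
      N.submatrix i.succAbove p.succAbove := by
    intro i
    ext x y
    exact hMN _ _ (Or.inr (Fin.succAbove_ne p y))
  simp only [hs] at hd
  rw [← Finset.add_sum_erase _ _ (Finset.mem_univ p),
    ← Finset.add_sum_erase _ _ (Finset.mem_univ p)] at hd
  rw [Finset.sum_congr rfl (fun i hi => by
    rw [hMN i p (Or.inl (Finset.ne_of_mem_erase hi))])] at hd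
  have := add_right_cancel hd
  rw [hc] at this
  have h1 : ((-1 : K) ^ ((p : ℕ) + (p : ℕ))) = 1 := Even.neg_one_pow ⟨_, rfl⟩
  simpa [h1] using this

lemma row_up {m h : ℕ} (C D : ℤ → ℤ → K) (hC : IsSLFrieze (m + 1) h C)
    (hD : IsSLFrieze (m + 1) h D) (a : ℤ)
    (hr : ∀ i : ℤ, a ≤ i → i < a + m + 1 → ∀ c, C i c = D i c) (c : ℤ) :
    C (a + m + 1) c = D (a + m + 1) c := by
  obtain ⟨⟨c1, c2, c3⟩, c4, c5⟩ := hC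
  obtain ⟨⟨d1, d2, d3⟩, d4, d5⟩ := hD
  suffices H : ∀ N : ℕ, ∀ c : ℤ, c ≤ a + m + 1 - h + N → C (a + m + 1) c = D (a + m + 1) c from
    H (c - (a + m + 1 - h)).toNat c (by omega)
  intro N
  induction N with
  | zero =>
    intro c hc
    rcases eq_or_lt_of_le hc with e | e
    · have := c2 c
      have := d2 c
      rw [show a + m + 1 = c + h by rw [e]; push_cast; ring]
      simp_all
    · rw [c3 _ _ (by right; push_cast at e; omega), d3 _ _ (by right; push_cast at e; omega)]
  | succ N ih =>
    intro c hc
    by_cases h0 : c ≤ a + m + 1 - h + N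
    · exact ih c h0
    by_cases h1 : a + m + 1 < c
    · rw [c3 _ _ (Or.inl h1), d3 _ _ (Or.inl h1)]
    by_cases h2 : a + m + 1 = c
    · rw [h2, c1, d1]
    push_cast at hc
    have k1 := c5 a (c - (m + 1)) (by omega) (by omega)
    have k2 := d5 a (c - (m + 1)) (by omega) (by omega)
    have k3 := d4 a (c - (m + 1)) (by omega) (by omega)
    rw [minor_Icc _ _ _ _ _ (m + 1 + 1) (by push_cast; ring) (by push_cast; ring)] at k1 k2
    rw [minor_Icc _ _ _ _ _ (m + 1) rfl rfl] at k3
    have := corner _ _ (Fin.last (m + 1)) ?_ (k1.trans k2.symm) ?_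
    · simp at this
      convert this using 1
      · rw [← add_assoc]
      · rw [← add_assoc]
    · intro i j hij
      simp only [Matrix.of_apply]
      by_cases hi : i = Fin.last (m + 1)
      · have hj := hij.resolve_left (not_not.2 hi)
        have hj' : (j : ℕ) < m + 1 := Fin.val_lt_last hj
        subst hi
        rw [show a + (((Fin.last (m + 1) : Fin (m + 1 + 1)) : ℕ) : ℤ) = a + m + 1 by
          simp; ring]
        exact ih _ (by omega)
      · have hi' : (i : ℕ) < m + 1 := Fin.val_lt_last hi
        exact hr _ (by omega) (by omega) _
    · rw [← k3]
      congr 1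
      ext i j
      simp

lemma row_down {m h : ℕ} (C D : ℤ → ℤ → K) (hC : IsSLFrieze (m + 1) h C)
    (hD : IsSLFrieze (m + 1) h D) (a : ℤ)
    (hr : ∀ i : ℤ, a < i → i ≤ a + m + 1 → ∀ c, C i c = D i c) (c : ℤ) :
    C a c = D a c := by
  obtain ⟨⟨c1, c2, c3⟩, c4, c5⟩ := hC
  obtain ⟨⟨d1, d2, d3⟩, d4, d5⟩ := hD
  suffices H : ∀ N : ℕ, ∀ c : ℤ, a - N ≤ c → C a c = D a c from
    H (a - c).toNat c (by omega)
  intro N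
  induction N with
  | zero =>
    intro c hc
    rcases eq_or_lt_of_le hc with e | e
    · rw [show c = a by rw [← e]; simp, c1, d1]
    · rw [c3 _ _ (by left; push_cast at e; omega), d3 _ _ (by left; push_cast at e; omega)]
  | succ N ih =>
    intro c hc
    by_cases h0 : a - N ≤ c
    · exact ih c h0
    by_cases h1 : c + h < a
    · rw [c3 _ _ (Or.inr h1), d3 _ _ (Or.inr h1)]
    by_cases h2 : a = c + h
    · rw [h2, c2, d2]
    push_cast at hc
    have k1 := c5 a c (by omega) (by omega)
    have k2 := d5 a c (by omega) (by omega)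
    have k3 := d4 (a + 1) (c + 1) (by omega) (by omega)
    rw [minor_Icc _ _ _ _ _ (m + 1 + 1) (by push_cast; ring) (by push_cast; ring)] at k1 k2
    rw [minor_Icc _ _ _ _ _ (m + 1) rfl rfl] at k3
    have := corner _ _ 0 ?_ (k1.trans k2.symm) ?_
    · simpa using this
    · intro i j hij
      simp only [Matrix.of_apply]
      by_cases hi : i = 0
      · have hj := hij.resolve_left (not_not.2 hi)
        have hj' : 0 < (j : ℕ) := Fin.pos_iff_ne_zero.2 hj
        subst hi
        simp only [Fin.val_zero, Nat.cast_zero, add_zero]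
        exact ih _ (by omega)
      · have hi' : 0 < (i : ℕ) := Fin.pos_iff_ne_zero.2 hi
        exact hr _ (by omega) (by omega) _
    · rw [← k3]
      congr 1
      ext i j
      simp
      congr 1 <;> ring

lemma frieze_unique {m h : ℕ} (C D : ℤ → ℤ → K) (hC : IsSLFrieze (m + 1) h C)
    (hD : IsSLFrieze (m + 1) h D) (a : ℤ)
    (hr : ∀ i : ℤ, a ≤ i → i < a + m + 1 → ∀ c, C i c = D i c) : C = D := by
  have H : ∀ t : ℤ, ∀ i : ℤ, a + t ≤ i → i < a + t + m + 1 → ∀ c, C i c = D i c := by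
    intro t
    induction t using Int.induction_on with
    | zero => simpa using hr
    | succ t ih =>
      intro i h1 h2 c
      by_cases h3 : i < a + t + m + 1
      · exact ih i (by omega) h3 c
      · have := row_up C D hC hD (a + t) ih c
        rwa [show i = a + t + m + 1 by omega]
    | pred t ih =>
      intro i h1 h2 c
      by_cases h3 : a + -t ≤ i
      · exact ih i (by omega) (by omega) c
      · have := row_down C D hC hD (a + (-t - 1)) (fun i h1 h2 => ih i (by omega) (by omega)) c
        rwa [show i = a + (-t - 1) by omega]
  ext i c
  exact H (i - a) i (by omega) (by omega) c

lemma cext_range {m n : ℕ} [NeZero n] (A : Matrix (Fin (m + 1)) (Fin n) K) (j : Fin n)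
    (b : ℤ) (hb : b = 1 + ((j : ℕ) : ℤ)) (i : Fin (m + 1)) : cext A b i = A i j := by
  have hn : (0 : ℤ) < n := by exact_mod_cast Nat.pos_of_ne_zero (NeZero.ne n)
  have h1 : (b - 1) / (n : ℤ) = 0 := Int.ediv_eq_zero_of_lt (by omega) (by omega)
  have h2 : resFin n b = j := by
    apply Fin.ext
    have := resFin_val n b
    rw [Int.emod_eq_of_lt (by omega) (by omega)] at this
    omega
  unfold cext
  rw [h1, h2]
  simp

lemma Lam_mul_A {m n h : ℕ} [NeZero n] (hmn : m + 1 < n) (hh : n = m + 1 + h)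
    (A : Matrix (Fin (m + 1)) (Fin n) K) (i : Fin (m + 1)) (j : Fin n) :
    (Lam A (h + 1) (m + 1) * A) i j = FCU n A (h + 1 + ((i : ℕ) : ℤ)) (1 + ((j : ℕ) : ℤ)) := by
  rw [FCU_eq hmn _ _ _ (by omega) (by omega), L_eq, Matrix.mul_apply]
  refine Finset.sum_congr rfl fun l _ => ?_
  rw [cext_range A j _ rfl]
  rfl

lemma G_one {r : ℕ} (G U U' V V' : Matrix (Fin r) (Fin r) K)
    (hU : ∀ i j, j < i → U i j = 0) (hU' : ∀ i j, j < i → U' i j = 0)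
    (hV : ∀ i j, i < j → V i j = 0) (hV' : ∀ i j, i < j → V' i j = 0)
    (hU1 : ∀ i, U i i = 1) (hU1' : ∀ i, U' i i = 1)
    (hV1 : ∀ i, V i i = 1) (e1 : G * U = U') (e2 : G * V = V') : G = 1 := by
  have h1 : ∀ l i, l ≤ i → G i l = U' i l := by
    intro l
    induction l using WellFoundedLT.induction with
    | _ l ih =>
      intro i hi
      rw [← e1, Matrix.mul_apply, Finset.sum_eq_single l, hU1, mul_one]
      · intro b _ hb
        rcases lt_or_gt_of_ne hb with h | h
        · rw [ih b h i (h.le.trans hi), hU' _ _ (h.trans_le hi), zero_mul]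
        · rw [hU _ _ h, mul_zero]
      · simp
  have h2 : ∀ l i, i < l → G i l = V' i l := by
    intro l
    induction l using WellFoundedGT.induction with
    | _ l ih =>
      intro i hi
      rw [← e2, Matrix.mul_apply, Finset.sum_eq_single l, hV1, mul_one]
      · intro b _ hb
        rcases lt_or_gt_of_ne hb with h | h
        · rw [hV _ _ h, mul_zero]
        · rw [ih b h i (hi.trans h), hV' _ _ (hi.trans h), zero_mul]
      · simp
  ext i j
  rcases lt_trichotomy i j with h | h | h
  · rw [h2 _ _ h, hV' _ _ h, Matrix.one_apply_ne h.ne]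
  · subst h
    rw [h1 _ _ le_rfl, hU1', Matrix.one_apply_eq]
  · rw [h1 _ _ h.le, hU' _ _ h, Matrix.one_apply_ne h.ne']

lemma resFin_add_mul (n : ℕ) [NeZero n] (a q : ℤ) : resFin n (a + q * n) = resFin n a := by
  apply Fin.ext
  have h1 := resFin_val n a
  have h2 := resFin_val n (a + q * n)
  have : (a + q * n - 1) % (n : ℤ) = (a - 1) % n := by
    rw [show a + q * n - 1 = a - 1 + q * n by ring, Int.add_mul_emod_self_right]
  omega

lemma det_two_tri {k : ℕ} (M : Matrix (Fin k) (Fin k) K) (r : ℕ)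
    (h1 : ∀ i j : Fin k, (j : ℕ) < r → j < i → M i j = 0)
    (h2 : ∀ i j : Fin k, r ≤ (j : ℕ) → i < j → M i j = 0)
    (hd : ∀ i, M i i = 1) : M.det = 1 := by
  rw [Matrix.twoBlockTriangular_det M (fun i => (i : ℕ) < r), Matrix.det_of_isUpperTriangular,
    Matrix.det_of_isLowerTriangular]
  · simp [Matrix.toSquareBlockProp, hd]
  · intro i j hij
    have hij : i < j := by simpa using hij
    exact h2 _ _ (not_lt.1 j.2) hij
  · intro i j hij
    have hij : j < i := by simpa using hij
    exact h1 _ _ j.2 hij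
  · intro i hi j hj
    exact h1 _ _ hj (by rw [Fin.lt_def]; omega)

lemma CU_of_frieze {m n h : ℕ} [NeZero n] (hmn : m + 1 < n) (hh : n = m + 1 + h)
    (C : ℤ → ℤ → K) (hC : IsSLFrieze (m + 1) h C) (A : Matrix (Fin (m + 1)) (Fin n) K)
    (hA : ∀ i j, A i j = C (h + 1 + ((i : ℕ) : ℤ)) (1 + ((j : ℕ) : ℤ))) :
    ConsecUnimodular n A := by
  obtain ⟨⟨c1, c2, c3⟩, c4, c5⟩ := hC
  have hn : (0 : ℤ) < n := by omega
  have hext : ∀ b : ℤ, 1 ≤ b → b ≤ n → ∀ i, cext A b i = C (h + 1 + ((i : ℕ) : ℤ)) b := by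
    intro b hb1 hb2 i
    rw [cext_range A ⟨(b - 1).toNat, by omega⟩ b (by simp only; omega), hA]
    congr 1
    simp only
    omega
  have main : ∀ a : ℤ, 1 ≤ a → a ≤ n →
      cdet A (Finset.Icc a (a + ((m + 1 : ℕ) : ℤ) - 1)) = 1 := by
    intro a ha1 ha2
    by_cases ha : a ≤ h + 1
    · rw [cdet_Icc hmn]
      have k := c4 (h + 1) a ha (by omega)
      rw [minor_Icc _ _ _ _ _ (m + 1) rfl rfl] at k
      rw [← k]
      unfold W
      congr 1
      ext i j
      exact hext (a + ((j : ℕ) : ℤ)) (by omega) (by omega) i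
    · obtain ⟨r, hr⟩ : ∃ r : ℕ, (r : ℤ) = a + m - n := ⟨(a + m - n).toNat, by omega⟩
      have hrm : r ≤ m := by omega
      have hr0 : 0 < r := by omega
      set s : Fin (m + 1) → ℤ := fun j =>
        if (j : ℕ) < r then ((j : ℕ) : ℤ) + 1 else ((j : ℕ) : ℤ) + h + 1 with hs
      have hs1 : ∀ j : Fin (m + 1), (j : ℕ) < r → s j = ((j : ℕ) : ℤ) + 1 := fun j hj => by
        simp only [hs]; rw [if_pos hj]
      have hs2 : ∀ j : Fin (m + 1), r ≤ (j : ℕ) → s j = ((j : ℕ) : ℤ) + h + 1 := fun j hj => by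
        simp only [hs]; rw [if_neg (by omega)]
      have hsr : ∀ j, 1 ≤ s j ∧ s j ≤ n := by
        intro j
        by_cases hj : (j : ℕ) < r
        · rw [hs1 j hj]; omega
        · rw [hs2 j (by omega)]; omega
      have : cdet A (Finset.Icc a (a + ((m + 1 : ℕ) : ℤ) - 1)) =
          cdet A (Finset.univ.image s) := by
        apply cdet_congr
        ext x
        simp only [Finset.mem_image, Finset.mem_univ, true_and, exists_exists_eq_and,
          Finset.mem_Icc]
        constructor
        · rintro ⟨y, hy, rfl⟩
          by_cases hyn : y ≤ n
          · refine ⟨⟨(y - h - 1).toNat, by omega⟩, ?_⟩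
            rw [hs2 _ (by simp only; omega)]
            congr 1
            simp only
            omega
          · refine ⟨⟨(y - n - 1).toNat, by omega⟩, ?_⟩
            rw [hs1 _ (by simp only; omega), ← resFin_add]
            congr 1
            simp only
            omega
        · rintro ⟨j, rfl⟩
          by_cases hj : (j : ℕ) < r
          · refine ⟨s j + n, ?_, resFin_add _ _⟩
            rw [hs1 j hj]; omega
          · refine ⟨s j, ?_, rfl⟩
            rw [hs2 j (by omega)]; omega
      rw [this, cdet_eq]
      · apply det_two_tri _ r
        · intro i j hj hij
          rw [Fin.lt_def] at hij
          rw [Matrix.of_apply, hext _ (hsr j).1 (hsr j).2, hs1 j hj]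
          exact c3 _ _ (by omega)
        · intro i j hj hij
          rw [Fin.lt_def] at hij
          rw [Matrix.of_apply, hext _ (hsr j).1 (hsr j).2, hs2 j hj]
          exact c3 _ _ (by omega)
        · intro i
          rw [Matrix.of_apply, hext _ (hsr i).1 (hsr i).2]
          by_cases hi : (i : ℕ) < r
          · rw [hs1 i hi, ← c2 (((i : ℕ) : ℤ) + 1)]
            congr 1
            ring
          · rw [hs2 i (by omega), ← c1 (((i : ℕ) : ℤ) + h + 1)]
            congr 1
            ring
      · intro x y hxy
        rw [Fin.lt_def] at hxy
        by_cases hx : (x : ℕ) < r <;> by_cases hy : (y : ℕ) < r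
        · rw [hs1 x hx, hs1 y hy]; omega
        · rw [hs1 x hx, hs2 y (by omega)]; omega
        · omega
        · rw [hs2 x (by omega), hs2 y (by omega)]; omega
      · intro x y
        have := hsr x
        have := hsr y
        omega
  intro a
  have h1 := Int.emod_nonneg (a - 1) hn.ne'
  have h2 := Int.emod_lt_of_pos (a - 1) hn
  rw [← main ((a - 1) % n + 1) (by omega) (by omega)]
  apply cdet_congr
  have h3 : a = (a - 1) % n + 1 + (a - 1) / n * n := by
    have := Int.emod_add_ediv_mul (a - 1) n
    linarith
  have h4 : Finset.Icc a (a + ((m + 1 : ℕ) : ℤ) - 1) =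
      (Finset.Icc ((a - 1) % n + 1) ((a - 1) % n + 1 + ((m + 1 : ℕ) : ℤ) - 1)).image
        (fun x => x + (a - 1) / n * n) := by
    rw [Finset.image_add_right_Icc, ← h3]
    congr 1
    linarith
  rw [h4, Finset.image_image]
  congr 1
  ext x
  simp [resFin_add_mul]

lemma FCU_of_frieze {m n h : ℕ} [NeZero n] (hmn : m + 1 < n) (hh : n = m + 1 + h)
    (C : ℤ → ℤ → K) (hC : IsSLFrieze (m + 1) h C) (A : Matrix (Fin (m + 1)) (Fin n) K)
    (hA : ∀ i j, A i j = C (h + 1 + ((i : ℕ) : ℤ)) (1 + ((j : ℕ) : ℤ)))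
    (hCU : ConsecUnimodular n A) : FCU n A = C := by
  have hD := FCU_frieze hmn hh A hCU
  set D := FCU n A with hDdef
  set G := Lam A (h + 1) (m + 1) with hG
  have key : ∀ (i : Fin (m + 1)) (b : ℤ), 1 ≤ b → b ≤ n →
      ∑ l, G i l * C (h + 1 + ((l : ℕ) : ℤ)) b = D (h + 1 + ((i : ℕ) : ℤ)) b := by
    intro i b hb1 hb2
    have := Lam_mul_A hmn hh A i ⟨(b - 1).toNat, by omega⟩
    rw [Matrix.mul_apply] at this
    simp only [hA] at this
    rw [show (1 + (((b - 1).toNat : ℕ) : ℤ)) = b by omega] at this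
    exact this
  have hG1 : G = 1 := by
    have aux : ∀ C : ℤ → ℤ → K, IsSLFrieze (m + 1) h C →
        (∀ i j : Fin (m + 1), j < i → C (h + 1 + ((i : ℕ) : ℤ)) (1 + ((j : ℕ) : ℤ)) = 0) ∧
        (∀ i j : Fin (m + 1), i < j → C (h + 1 + ((i : ℕ) : ℤ)) (h + 1 + ((j : ℕ) : ℤ)) = 0) ∧
        (∀ i : Fin (m + 1), C (h + 1 + ((i : ℕ) : ℤ)) (1 + ((i : ℕ) : ℤ)) = 1) ∧
        (∀ i : Fin (m + 1), C (h + 1 + ((i : ℕ) : ℤ)) (h + 1 + ((i : ℕ) : ℤ)) = 1) := by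
      rintro C ⟨⟨c1, c2, c3⟩, -, -⟩
      refine ⟨?_, ?_, ?_, fun i => c1 _⟩
      · intro i j hij
        rw [Fin.lt_def] at hij
        exact c3 _ _ (by omega)
      · intro i j hij
        rw [Fin.lt_def] at hij
        exact c3 _ _ (by omega)
      · intro i
        rw [← c2 (1 + ((i : ℕ) : ℤ))]
        congr 1
        ring
    obtain ⟨a1, a2, a3, a4⟩ := aux C hC
    obtain ⟨b1, b2, b3, b4⟩ := aux D hD
    refine G_one G
      (Matrix.of fun i j => C (h + 1 + ((i : ℕ) : ℤ)) (1 + ((j : ℕ) : ℤ)))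
      (Matrix.of fun i j => D (h + 1 + ((i : ℕ) : ℤ)) (1 + ((j : ℕ) : ℤ)))
      (Matrix.of fun i j => C (h + 1 + ((i : ℕ) : ℤ)) (h + 1 + ((j : ℕ) : ℤ)))
      (Matrix.of fun i j => D (h + 1 + ((i : ℕ) : ℤ)) (h + 1 + ((j : ℕ) : ℤ)))
      a1 b1 a2 b2 a3 b3 a4 ?_ ?_
    · ext i j
      rw [Matrix.mul_apply]
      exact key i _ (by omega) (by omega)
    · ext i j
      rw [Matrix.mul_apply]
      exact key i _ (by omega) (by omega)
  refine frieze_unique D C hD hC (h + 1) ?_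
  intro i hi1 hi2 c
  by_cases hc1 : 1 ≤ c
  · by_cases hc2 : c ≤ n
    · have := key ⟨(i - (h + 1)).toNat, by omega⟩ c hc1 hc2
      rw [hG1] at this
      simp only [Matrix.one_apply, ite_mul, one_mul, zero_mul, Finset.sum_ite_eq,
        Finset.mem_univ, if_true] at this
      rw [show (h + 1 + (((i - (h + 1)).toNat : ℕ) : ℤ)) = i by omega] at this
      exact this.symm
    · rw [hD.1.2.2 i c (by omega), hC.1.2.2 i c (by omega)]
  · rw [hD.1.2.2 i c (by omega), hC.1.2.2 i c (by omega)]

lemma cdet_mul {k n : ℕ} [NeZero n] (G : Matrix (Fin k) (Fin k) K)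
    (A : Matrix (Fin k) (Fin n) K) (I : Finset ℤ) : cdet (G * A) I = G.det * cdet A I := by
  unfold cdet
  split_ifs with h
  · rw [← Matrix.det_mul]
    congr 1
  · simp

/-- **`F` is a bijection for `SL(k)`-friezes.** For `0 < k < n`:
(i) every `SL(k)`-frieze of height `n - k` equals `F(A)` for some consecutively
unimodular `k × n` matrix `A`; and (ii) two consecutively unimodular matrices have
the same image under `F` iff they differ by left multiplication by an element of
`SL(k)`.  Hence `F` induces a bijection from `SL(k)`-orbits of consecutively
unimodular `k × n` matrices onto the set of `SL(k)`-friezes of height `n - k`. -/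
theorem FCU_bijective (n k : ℕ) [NeZero n] (hk : 0 < k) (hkn : k < n) :
    (∀ C : ℤ → ℤ → K, IsSLFrieze k (n - k) C →
        ∃ A : Matrix (Fin k) (Fin n) K, ConsecUnimodular n A ∧ FCU n A = C) ∧
    (∀ A A' : Matrix (Fin k) (Fin n) K, ConsecUnimodular n A → ConsecUnimodular n A' →
        (FCU n A = FCU n A' ↔
          ∃ G : Matrix (Fin k) (Fin k) K, G.det = 1 ∧ A' = G * A)) := by
  obtain ⟨m, rfl⟩ : ∃ m, k = m + 1 := ⟨k - 1, by omega⟩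
  obtain ⟨h, hh⟩ : ∃ h, n = m + 1 + h := ⟨n - (m + 1), by omega⟩
  have hnk : n - (m + 1) = h := by omega
  rw [hnk]
  refine ⟨?_, ?_⟩
  · intro C hC
    have hCU := CU_of_frieze hkn hh C hC
      (Matrix.of fun i j => C (h + 1 + ((i : ℕ) : ℤ)) (1 + ((j : ℕ) : ℤ))) (fun _ _ => rfl)
    exact ⟨_, hCU, FCU_of_frieze hkn hh C hC _ (fun _ _ => rfl) hCU⟩
  · intro A A' hA hA'
    constructor
    · intro hF
      have e : Lam A (h + 1) (m + 1) * A = Lam A' (h + 1) (m + 1) * A' := by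
        ext i j
        rw [Lam_mul_A hkn hh, Lam_mul_A hkn hh, hF]
      have d := det_Lam hkn A hA (h + 1)
      have d' := det_Lam hkn A' hA' (h + 1)
      refine ⟨(Lam A' (h + 1) (m + 1))⁻¹ * Lam A (h + 1) (m + 1), ?_, ?_⟩
      · rw [Matrix.det_mul, Matrix.det_nonsing_inv, d, d']
        simp
      · rw [Matrix.mul_assoc, e, ← Matrix.mul_assoc, Matrix.nonsing_inv_mul _ (by rw [d']; simp),
          Matrix.one_mul]
    · rintro ⟨G, hG, rfl⟩
      ext a b
      unfold FCU
      rw [cdet_mul, hG, one_mul]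
end
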